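/- arXiv:1802.06419 — 7 statements merged into one kernel-verified Lean document; each statement's English description precedes it below -/
import Mathlib

section
/- Gurau's theorem (permutation model): Let d ≥ 1 and n ≥ 1, and let G = (σ_0, σ_1, …, σ_d) be a connected colored graph with colors {0,…,d} on 2n vertices. Then the total number of bicolored cycles satisfies C(G) ≤ d + d(d−1)·n/2; equivalently, Gurau's degree ω(G) = d + d(d−1)·n/2 − C(G) is a non-negative integer. -/
/-- The setoid on `α` whose classes are the cycles (orbits) of the permutation `π`. -/
def permSetoid {α : Type*} (π : Equiv.Perm α) : Setoid α :=
  ⟨π.SameCycle, ⟨fun _ => ⟨0, by simp⟩, fun h => h.symm, fun h h' => h.trans h'⟩⟩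

/-- The number of cycles (orbits) of a permutation. -/
noncomputable def numCycles {α : Type*} (π : Equiv.Perm α) : ℕ :=
  Nat.card (Quotient (permSetoid π))

/-- Connectivity of the colored graph `(σ 0, …, σ d)`: the subgroup generated by the
`(σ a)⁻¹ * σ b` acts transitively on the white vertices. -/
def ColoredConnected {n d : ℕ} (σ : Fin (d + 1) → Equiv.Perm (Fin n)) : Prop :=
  ∀ x y : Fin n,
    ∃ g ∈ Subgroup.closure {g : Equiv.Perm (Fin n) | ∃ a b : Fin (d + 1), g = (σ a)⁻¹ * σ b},
      g x = y

/-- Total number of bicolored cycles `C(G) = Σ_{a<b} C_{ab}(G)`. -/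
noncomputable def totalCycles {n d : ℕ} (σ : Fin (d + 1) → Equiv.Perm (Fin n)) : ℕ :=
  ∑ p ∈ Finset.univ.filter (fun p : Fin (d + 1) × Fin (d + 1) => p.1 < p.2),
    numCycles ((σ p.1)⁻¹ * σ p.2)

open Equiv Finset

/-- number of classes -/
noncomputable def gCls {α : Type*} (r : Setoid α) : ℕ := Nat.card (Quotient r)

open Classical in
/-- merging two classes -/
noncomputable def gMerge {α : Type*} (r : Setoid α) (x y : α) : Setoid α :=
  Setoid.ker (fun a : α => if (Quotient.mk r a) = Quotient.mk r y then Quotient.mk r x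
    else Quotient.mk r a)

open Classical in
lemma gMerge_iff {α : Type*} (r : Setoid α) (x y a b : α) : (gMerge r x y) a b ↔
    (if (Quotient.mk r a) = Quotient.mk r y then Quotient.mk r x else Quotient.mk r a) =
    (if (Quotient.mk r b) = Quotient.mk r y then Quotient.mk r x else Quotient.mk r b) := Iff.rfl

lemma gMerge_le {α : Type*} (r : Setoid α) (x y : α) : r ≤ gMerge r x y := by
  intro a b h
  have : Quotient.mk r a = Quotient.mk r b := Quotient.sound h
  change (gMerge r x y) a b
  rw [gMerge_iff, this]

lemma gMerge_rel {α : Type*} (r : Setoid α) (x y : α) : (gMerge r x y) x y := by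
  simp [gMerge_iff]

lemma gMerge_least {α : Type*} (r s : Setoid α) (x y : α) (h : r ≤ s) (hxy : s x y) :
    gMerge r x y ≤ s := by
  intro a b hab
  change (gMerge r x y) a b at hab
  simp only [gMerge_iff] at hab
  split_ifs at hab with h1 h2 h2
  · exact s.trans (h (Quotient.exact h1)) (s.symm (h (Quotient.exact h2)))
  · exact s.trans (h (Quotient.exact h1)) (s.trans (s.symm hxy) (h (Quotient.exact hab)))
  · exact s.trans (h (Quotient.exact hab)) (s.trans hxy (s.symm (h (Quotient.exact h2))))
  · exact h (Quotient.exact hab)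

lemma gCls_merge {α : Type*} [Finite α] (r : Setoid α) (x y : α) :
    gCls r ≤ gCls (gMerge r x y) + 1 := by
  classical
  let F : Quotient r → Option (Quotient (gMerge r x y)) := fun q =>
    if q = Quotient.mk r y then none
    else some (Quotient.map' id (fun a b h => gMerge_le r x y h) q)
  have hF : Function.Injective F := by
    intro a b
    induction a using Quotient.inductionOn with | _ a
    induction b using Quotient.inductionOn with | _ b
    intro hab
    simp only [F] at hab
    split_ifs at hab with h1 h2 h2
    · rw [h1, h2]
    · have h3 := Quotient.exact (Option.some.inj hab)
      change (gMerge r x y) a b at h3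
      simpa [gMerge_iff, h1, h2] using h3
  have := Nat.card_le_card_of_injective F hF
  rwa [Finite.card_option] at this

lemma gCls_anti {α : Type*} [Finite α] {r s : Setoid α} (h : r ≤ s) : gCls s ≤ gCls r :=
  Nat.card_le_card_of_surjective (Quotient.map' id (fun _ _ hab => h hab)) (by
    intro b
    induction b using Quotient.inductionOn with | _ b
    exact ⟨Quotient.mk r b, rfl⟩)

lemma gCls_strict {α : Type*} [Finite α] {r s : Setoid α} (h : r ≤ s) {x y : α}
    (hs : s x y) (hr : ¬ r x y) : gCls s < gCls r := by
  refine lt_of_le_of_ne (gCls_anti h) fun he => ?_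
  let f : Quotient r → Quotient s := Quotient.map' id (fun _ _ hab => h hab)
  have hf : Function.Surjective f := by
    intro b
    induction b using Quotient.inductionOn with | _ b
    exact ⟨Quotient.mk r b, rfl⟩
  have hb : Function.Bijective f := (Nat.bijective_iff_surjective_and_card f).2 ⟨hf, he.symm⟩
  have : Quotient.mk r x = Quotient.mk r y := hb.1 (Quotient.sound hs)
  exact hr (Quotient.exact this)

lemma gCls_le_card {α : Type*} [Finite α] (r : Setoid α) : gCls r ≤ Nat.card α :=
  Nat.card_le_card_of_surjective (Quotient.mk r) Quotient.mk_surjective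

lemma gCls_bot {α : Type*} [Finite α] : Nat.card α ≤ gCls (⊥ : Setoid α) :=
  Nat.card_le_card_of_injective (Quotient.mk (⊥ : Setoid α)) fun _ _ h => Quotient.exact h

lemma gPerm_le {α : Type*} [Finite α] (p : Perm α) (r : Setoid α) (h : ∀ a, r a (p a)) :
    permSetoid p ≤ r := by
  intro a b hab
  obtain ⟨k, -, rfl⟩ := Equiv.Perm.SameCycle.exists_pow_eq' (f := p) hab
  clear hab
  induction k with
  | zero => exact r.refl _
  | succ k ih => rw [pow_succ']; exact r.trans ih (h _)

lemma gPerm_rel {α : Type*} (p : Perm α) (a : α) : permSetoid p a (p a) := ⟨1, by simp⟩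

lemma g_same {α : Type*} [Finite α] [DecidableEq α] (p : Perm α) (x y : α)
    (h : ¬ permSetoid p x y) : permSetoid (p * swap x y) x y := by
  set q := p * swap x y with hq
  by_contra hc
  have key : ∀ j : ℕ, permSetoid q y ((p ^ (j + 1)) x) := by
    intro j
    induction j with
    | zero =>
      have := gPerm_rel q y
      simpa [hq] using this
    | succ j ih =>
      have h1 : (p ^ (j + 1)) x ≠ x := by
        intro he
        rw [he] at ih
        exact hc ((permSetoid q).symm ih)
      have h2 : (p ^ (j + 1)) x ≠ y := by
        intro he
        exact h ⟨(j + 1 : ℕ), by rw [zpow_natCast]; exact he⟩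
      have h3 := gPerm_rel q ((p ^ (j + 1)) x)
      have h4 : q ((p ^ (j + 1)) x) = (p ^ (j + 1 + 1)) x := by
        rw [hq, Perm.mul_apply, swap_apply_of_ne_of_ne h1 h2, pow_succ' p (j + 1), Perm.mul_apply]
      rw [h4] at h3
      exact (permSetoid q).trans ih h3
  have ho := orderOf_pos p
  have := key (orderOf p - 1)
  rw [Nat.sub_add_cancel ho, pow_orderOf_eq_one] at this
  exact hc ((permSetoid q).symm this)

lemma g_le_merge {α : Type*} [Finite α] [DecidableEq α] (p : Perm α) (x y : α) (s : Setoid α)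
    (h : permSetoid (p * swap x y) ≤ s) (hxy : s x y) : permSetoid p ≤ s := by
  apply gPerm_le
  intro a
  have h1 : s (swap x y a) (p a) := by
    have := h (gPerm_rel (p * swap x y) (swap x y a))
    simpa using this
  refine s.trans ?_ h1
  rcases eq_or_ne a x with rfl | hx
  · simpa using hxy
  rcases eq_or_ne a y with rfl | hy
  · simpa using s.symm hxy
  rw [swap_apply_of_ne_of_ne hx hy]

lemma numCycles_eq {α : Type*} (p : Perm α) : numCycles p = gCls (permSetoid p) := rfl

lemma g_A1 {α : Type*} [Finite α] [DecidableEq α] (p : Perm α) (x y : α) :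
    numCycles (p * swap x y) ≤ numCycles p + 1 := by
  rw [numCycles_eq, numCycles_eq]
  have h1 := gCls_merge (permSetoid (p * swap x y)) x y
  have h2 := gCls_anti (g_le_merge p x y _ (gMerge_le (permSetoid (p * swap x y)) x y)
    (gMerge_rel _ x y))
  omega

lemma g_A2 {α : Type*} [Finite α] [DecidableEq α] (p : Perm α) (x y : α)
    (h : ¬ permSetoid p x y) : numCycles (p * swap x y) < numCycles p := by
  have hs := g_same p x y h
  exact gCls_strict (g_le_merge p x y _ le_rfl hs) hs h

lemma g_step {α : Type*} [Finite α] [DecidableEq α] (p : Perm α) (x y : α) (r : Setoid α)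
    (hp : ∀ a, r a (p a)) : ∃ r' : Setoid α, r ≤ r' ∧ r' x y ∧
      2 * gCls r + numCycles (p * swap x y) ≤ 2 * gCls r' + 1 + numCycles p := by
  by_cases hxy : r x y
  · refine ⟨r, le_rfl, hxy, ?_⟩
    have := g_A1 p x y
    omega
  · refine ⟨gMerge r x y, gMerge_le r x y, gMerge_rel r x y, ?_⟩
    have := g_A2 p x y fun h => hxy (gPerm_le p r hp h)
    have := gCls_merge r x y
    omega

lemma g_mul {α : Type*} [Finite α] [DecidableEq α] (N : ℕ) : ∀ (p π : Perm α) (r : Setoid α)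
    (_ : ∀ a, r a (p a)) (_ : Nat.card α - numCycles π ≤ N),
    ∃ r' : Setoid α, r ≤ r' ∧ (∀ a, r' a (π a)) ∧
      2 * gCls r + numCycles (p * π) + numCycles π ≤ 2 * gCls r' + Nat.card α + numCycles p := by
  induction N with
  | zero =>
    intro p π r hp hN
    have hle := gCls_le_card (permSetoid (1 : Perm α))
    rw [← numCycles_eq] at hle
    by_cases h1 : π = 1
    · subst h1
      exact ⟨r, le_rfl, fun a => r.refl a, by simp only [mul_one]; omega⟩
    · exfalso
      obtain ⟨x, hx⟩ : ∃ x, π x ≠ x := by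
        by_contra! h
        exact h1 (Perm.ext h)
      have hbot := gCls_strict (bot_le : (⊥ : Setoid α) ≤ permSetoid π) (gPerm_rel π x)
        (fun h => hx (Eq.symm h))
      have := gCls_le_card (⊥ : Setoid α)
      rw [← numCycles_eq] at hbot
      omega
  | succ N ih =>
    intro p π r hp hN
    by_cases h1 : π = 1
    · have hle := gCls_le_card (permSetoid (1 : Perm α))
      rw [← numCycles_eq] at hle
      subst h1
      exact ⟨r, le_rfl, fun a => r.refl a, by simp only [mul_one]; omega⟩
    · obtain ⟨x, hx⟩ : ∃ x, π x ≠ x := by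
        by_contra! h
        exact h1 (Perm.ext h)
      set y := π x with hy
      set π' := π * swap x y with hπ'
      have hfix : π' y = y := by simp [hπ', hy]
      have hback : π' * swap x y = π := by simp [hπ', mul_assoc]
      have hns : ¬ permSetoid π' x y := by
        intro h
        have h' : π'.SameCycle y x := Perm.SameCycle.symm h
        obtain ⟨k, -, hk⟩ := h'.exists_pow_eq'
        rw [Perm.pow_apply_eq_self_of_apply_eq_self hfix] at hk
        exact hx hk
      have hlt := g_A2 π' x y hns
      rw [hback] at hlt
      obtain ⟨r1, hr1, hπ1, hb1⟩ := ih p π' r hp (by omega)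
      obtain ⟨r2, hr2, hxy, hb2⟩ := g_step (p * π') x y r1
        (fun a => r1.trans (hπ1 a) (hr1 (hp _)))
      rw [mul_assoc, hback] at hb2
      refine ⟨r2, hr1.trans hr2, ?_, by omega⟩
      intro a
      refine g_le_merge π x y r2 ?_ hxy (gPerm_rel π a)
      exact gPerm_le _ _ fun a => hr2 (hπ1 a)

lemma g_chain {α : Type*} [Finite α] [DecidableEq α] (s : ℕ → Perm α) (k : ℕ) :
    ∃ r : Setoid α, (∀ a, r a (((s 0)⁻¹ * s k) a)) ∧
      (∀ i ≤ k, ∀ a, r a (((s 0)⁻¹ * s i) a)) ∧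
      Nat.card α + numCycles ((s 0)⁻¹ * s k)
        + ∑ i ∈ range k, numCycles ((s i)⁻¹ * s (i + 1)) ≤ 2 * gCls r + k * Nat.card α := by
  induction k with
  | zero =>
    have h1 := gCls_bot (α := α)
    have h2 := gCls_le_card (permSetoid ((s 0)⁻¹ * s 0))
    rw [← numCycles_eq] at h2
    refine ⟨⊥, fun a => ?_, fun i hi a => ?_, ?_⟩
    · simp
    · obtain rfl : i = 0 := by omega
      simp
    · simp only [range_zero, sum_empty]; omega
  | succ k ih =>
    obtain ⟨r, h1, h2, h3⟩ := ih
    obtain ⟨r', hr, h4, h5⟩ := g_mul _ ((s 0)⁻¹ * s k) ((s k)⁻¹ * s (k + 1)) r h1 le_rfl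
    have he : (s 0)⁻¹ * s k * ((s k)⁻¹ * s (k + 1)) = (s 0)⁻¹ * s (k + 1) := by group
    have hk : ∀ a, r' a (((s 0)⁻¹ * s (k + 1)) a) := by
      intro a
      rw [← he]
      exact r'.trans (h4 a) (hr (h1 _))
    refine ⟨r', hk, ?_, ?_⟩
    · intro i hi a
      rcases Nat.lt_or_ge i (k + 1) with h | h
      · exact hr (h2 i (by omega) a)
      · obtain rfl : i = k + 1 := by omega
        exact hk a
    · rw [he] at h5
      rw [sum_range_succ, add_mul]
      omega

/-- The jacket bound. -/
lemma g_jacket {d n : ℕ} (σ : Fin (d + 1) → Perm (Fin n)) (hconn : ColoredConnected σ)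
    (τ : Perm (Fin (d + 1))) :
    n + numCycles ((σ (τ 0))⁻¹ * σ (τ (Fin.last d)))
      + ∑ i : Fin d, numCycles ((σ (τ i.castSucc))⁻¹ * σ (τ i.succ)) ≤ 2 + d * n := by
  obtain ⟨r, -, h2, h3⟩ := g_chain (fun k => σ (τ (Fin.ofNat (d + 1) k))) d
  rw [← Fin.sum_univ_eq_sum_range
    (fun i => numCycles ((σ (τ (Fin.ofNat (d + 1) i)))⁻¹ * σ (τ (Fin.ofNat (d + 1) (i + 1)))))] at h3
  have e0 : Fin.ofNat (d + 1) 0 = 0 := rfl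
  have ed : Fin.ofNat (d + 1) d = Fin.last d := by ext; simp
  have ec : ∀ i : Fin d, Fin.ofNat (d + 1) (i : ℕ) = i.castSucc := by
    intro i; ext; simp
  have es : ∀ i : Fin d, Fin.ofNat (d + 1) ((i : ℕ) + 1) = i.succ := by
    intro i; ext; simp
  have ha : ∀ (c : Fin (d + 1)) (a : Fin n), r a (((σ (τ 0))⁻¹ * σ c) a) := by
    intro c a
    have := h2 (τ.symm c) (by omega) a
    have e : Fin.ofNat (d + 1) ((τ.symm c : Fin (d + 1)) : ℕ) = τ.symm c := by
      ext; simp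
    simpa only [e, e0, apply_symm_apply] using this
  have hb : ∀ (b c : Fin (d + 1)) (a : Fin n), r a (((σ b)⁻¹ * σ c) a) := by
    intro b c a
    have h5 := ha b (((σ b)⁻¹ * σ c) a)
    have e : ((σ (τ 0))⁻¹ * σ b) (((σ b)⁻¹ * σ c) a) = ((σ (τ 0))⁻¹ * σ c) a := by simp
    rw [e] at h5
    exact r.trans (ha c a) (r.symm h5)
  have hall : ∀ x y, r x y := by
    intro x y
    obtain ⟨g, hg, rfl⟩ := hconn x y
    induction hg using Subgroup.closure_induction generalizing x with
    | mem g hg => obtain ⟨a, b, rfl⟩ := hg; exact hb a b x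
    | one => exact r.refl x
    | mul g h _ _ ig ih => exact r.trans (ih x) (ig (h x))
    | inv g _ ig =>
      have := ig (g⁻¹ x)
      have e : g (g⁻¹ x) = x := by simp
      rw [e] at this
      exact r.symm this
  have hc : gCls r ≤ 1 := by
    have : Subsingleton (Quotient r) := ⟨fun a b => by
      induction a using Quotient.inductionOn with | _ a
      induction b using Quotient.inductionOn with | _ b
      exact Quotient.sound (hall a b)⟩
    exact Finite.card_le_one_iff_subsingleton.2 this
  simp only [e0, ed, ec, es, Nat.card_eq_fintype_card, Fintype.card_fin] at h3
  omega

lemma g_symm {α : Type*} [Finite α] (p q : Perm α) :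
    numCycles (p⁻¹ * q) = numCycles (q⁻¹ * p) := by
  have : permSetoid (p⁻¹ * q) = permSetoid (q⁻¹ * p) := by
    ext a b
    have e : q⁻¹ * p = (p⁻¹ * q)⁻¹ := by group
    rw [e]
    exact Perm.sameCycle_inv.symm
  rw [numCycles_eq, numCycles_eq, this]

lemma g_indep {m : ℕ} (f : Fin m → Fin m → ℕ) (i j i' j' : Fin m) (h : i ≠ j) (h' : i' ≠ j') :
    ∑ τ : Perm (Fin m), f (τ i) (τ j) = ∑ τ : Perm (Fin m), f (τ i') (τ j') := by
  obtain ⟨ρ, h1, h2⟩ : ∃ ρ : Perm (Fin m), ρ i' = i ∧ ρ j' = j := by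
    refine ⟨swap (swap i' i j') j * swap i' i, ?_, ?_⟩
    · have : swap i' i j' ≠ i := fun hh => h' (by
        have := (swap i' i).injective (hh.trans (swap_apply_left i' i).symm)
        exact this.symm)
      simp [swap_apply_of_ne_of_ne this.symm h]
    · simp
  rw [← Equiv.sum_comp (Equiv.mulRight ρ) (fun τ : Perm (Fin m) => f (τ i') (τ j'))]
  simp [h1, h2]

/-- **Gurau's theorem** (permutation model): for a connected colored graph on `2n` vertices with
colors `{0,…,d}`, the total number of bicolored cycles satisfies
`C(G) ≤ d + d(d−1)·n/2`, stated here in the equivalent integer form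
`2·C(G) ≤ 2·d + d·(d−1)·n`; i.e. Gurau's degree is a non-negative integer. -/
theorem gurau_degree_bound {d n : ℕ} (hd : 1 ≤ d) (hn : 1 ≤ n)
    (σ : Fin (d + 1) → Equiv.Perm (Fin n)) (hconn : ColoredConnected σ) :
    2 * totalCycles σ ≤ 2 * d + d * (d - 1) * n := by
  set f : Fin (d + 1) → Fin (d + 1) → ℕ := fun a b => numCycles ((σ a)⁻¹ * σ b) with hf
  have hl : (0 : Fin (d + 1)) ≠ Fin.last d := by
    intro h
    have := congrArg Fin.val h
    simp at this
    omega
  set S := ∑ τ : Perm (Fin (d + 1)), f (τ 0) (τ (Fin.last d)) with hS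
  set M := Fintype.card (Perm (Fin (d + 1))) with hM
  have hMpos : 0 < M := Fintype.card_pos
  -- sum over jackets
  have hJ : M * n + S + d * S ≤ M * (2 + d * n) := by
    have h := Finset.sum_le_sum (fun τ (_ : τ ∈ (univ : Finset (Perm (Fin (d + 1))))) =>
      g_jacket σ hconn τ)
    rw [sum_add_distrib, sum_add_distrib, sum_comm] at h
    have : ∀ i : Fin d, ∑ τ : Perm (Fin (d + 1)), f (τ i.castSucc) (τ i.succ) = S := fun i =>
      g_indep f _ _ _ _ (Fin.castSucc_lt_succ (i := i)).ne hl
    simp only [hf] at this hS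
    simp only [this, ← hS, sum_const, card_univ, Fintype.card_fin, smul_eq_mul] at h
    exact h
  set D := (univ : Finset (Fin (d + 1) × Fin (d + 1))).filter (fun p => p.1 ≠ p.2) with hD
  have hDcard : D.card = (d + 1) * d := by
    have : D = (univ : Finset (Fin (d + 1))).offDiag := by ext; simp [hD]
    rw [this, offDiag_card]
    simp
    ring_nf
    omega
  have h2C : ∑ p ∈ D, f p.1 p.2 = 2 * totalCycles σ := by
    have hsplit : D = univ.filter (fun p : Fin (d + 1) × Fin (d + 1) => p.1 < p.2)
        ∪ univ.filter (fun p : Fin (d + 1) × Fin (d + 1) => p.2 < p.1) := by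
      ext p; simp [hD, lt_or_lt_iff_ne]
    rw [hsplit, sum_union, two_mul]
    · congr 1
      refine sum_bij (fun p _ => (p.2, p.1)) ?_ ?_ ?_ ?_
      · intro p hp; simpa using hp
      · rintro ⟨a, b⟩ _ ⟨a', b'⟩ _ h; simp at h; simp [h]
      · rintro ⟨a, b⟩ h; exact ⟨(b, a), by simpa using h, rfl⟩
      · intro p _; exact g_symm _ _
    · rw [disjoint_filter]
      intro p _ h1 h2
      exact lt_asymm h1 h2
  have hdouble : (d + 1) * d * S = M * (2 * totalCycles σ) := by
    have h1 : ∑ p ∈ D, ∑ τ : Perm (Fin (d + 1)), f (τ p.1) (τ p.2) = (d + 1) * d * S := by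
      rw [← hDcard, ← smul_eq_mul, ← sum_const]
      refine sum_congr rfl fun p hp => ?_
      exact g_indep f _ _ _ _ (by simpa [hD] using hp) hl
    rw [← h1, sum_comm, hM, ← card_univ, ← smul_eq_mul, ← sum_const]
    refine sum_congr rfl fun τ _ => ?_
    rw [← h2C]
    refine sum_bij (fun p _ => (τ p.1, τ p.2)) ?_ ?_ ?_ ?_
    · intro p hp; simpa [hD] using hp
    · rintro ⟨a, b⟩ _ ⟨a', b'⟩ _ h; simpa using h
    · rintro ⟨a, b⟩ h
      exact ⟨(τ.symm a, τ.symm b), by simpa [hD] using h, by simp⟩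
    · intro p _; rfl
  obtain ⟨e, rfl⟩ : ∃ e, d = e + 1 := ⟨d - 1, by omega⟩
  simp only [Nat.add_sub_cancel]
  refine Nat.le_of_mul_le_mul_left ?_ hMpos
  rw [← hdouble]
  have h3 : (e + 1 + 1) * S ≤ M * (2 + e * n) := by nlinarith
  calc (e + 1 + 1) * (e + 1) * S = (e + 1) * ((e + 1 + 1) * S) := by ring
    _ ≤ (e + 1) * (M * (2 + e * n)) := Nat.mul_le_mul_left _ h3
    _ = _ := by ring
end

section
/- Characterization of maximizers of the number of bicolored cycles (melonic graphs): Let d ≥ 3 and n ≥ 1. A connected colored graph G = (σ_0, …, σ_d) on 2n vertices satisfies C(G) = d + d(d−1)·n/2 (i.e. has vanishing Gurau degree) if and only if G is isomorphic, by independent relabelings of its white and of its black vertices, to a melonic colored graph. -/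
/-- Extension of a permutation of `Fin n` to `Fin (n+1)` fixing `Fin.last n` and acting
through `Fin.castSucc` on the other elements. -/
def liftPerm {n : ℕ} (τ : Equiv.Perm (Fin n)) : Equiv.Perm (Fin (n + 1)) :=
  (finSuccEquivLast (n := n)).symm.permCongr τ.optionCongr

/-- Melonic tuples of permutations (melonic colored graphs / bubbles), defined inductively by
melonic insertions starting from the 2-vertex graph: inserting on the edge of color `c` at the
white vertex `w` a new pair of vertices (`Fin.last n` both white and black) connected by all
colors except `c`. -/
inductive Melonic {ι : Type*} [DecidableEq ι] : {n : ℕ} → (ι → Equiv.Perm (Fin n)) → Prop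
  | base : Melonic (fun _ : ι => (1 : Equiv.Perm (Fin 1)))
  | insert {n : ℕ} {σ : ι → Equiv.Perm (Fin n)} (c : ι) (w : Fin n) :
      Melonic σ →
      Melonic (fun a =>
        if a = c then liftPerm (σ a) * Equiv.swap (Fin.castSucc w) (Fin.last n)
        else liftPerm (σ a))


open Equiv in
theorem numCycles_formula {α : Type*} [Fintype α] [DecidableEq α] (f : Perm α) :
    numCycles f + f.support.card = Fintype.card α + Multiset.card f.cycleType := by
  classical
  let φ : α → α ⊕ Perm α := fun x => if f x = x then Sum.inl x else Sum.inr (f.cycleOf x)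
  have hφ : permSetoid f = Setoid.ker φ := by
    ext x y
    show f.SameCycle x y ↔ φ x = φ y
    constructor
    · intro h
      by_cases hx : f x = x
      · have : x = y := by
          obtain ⟨i, hi⟩ := h
          rw [Perm.zpow_apply_eq_self_of_apply_eq_self hx] at hi
          exact hi
        rw [this]
      · have hy : ¬ f y = y := fun hy => hx (h.apply_eq_self_iff.2 hy)
        simp only [φ, if_neg hx, if_neg hy]
        rw [h.cycleOf_eq]
    · intro h
      by_cases hx : f x = x <;> by_cases hy : f y = y
      · simp only [φ, if_pos hx, if_pos hy] at h
        rw [Sum.inl.inj h]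
      · simp [φ, hx, hy] at h
      · simp [φ, hx, hy] at h
      · simp only [φ, if_neg hx, if_neg hy] at h
        exact (Perm.sameCycle_iff_cycleOf_eq_of_mem_support (Perm.mem_support.2 hx)
          (Perm.mem_support.2 hy)).2 (Sum.inr.inj h)
  have h1 : numCycles f = (Finset.univ.image φ).card := by
    unfold numCycles
    rw [hφ, Nat.card_congr (Setoid.quotientKerEquivRange φ), Nat.card_coe_set_eq,
      ← Set.ncard_coe_finset]
    simp
  have h2 : Finset.univ.image φ = (Finset.univ.filter (fun x => f x = x)).disjSum
      f.cycleFactorsFinset := by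
    ext z
    rcases z with z | z
    · simp only [Finset.mem_image, Finset.mem_univ, true_and, Finset.inl_mem_disjSum,
        Finset.mem_filter]
      constructor
      · rintro ⟨x, hx⟩
        by_cases h : f x = x
        · simp only [φ, if_pos h] at hx
          rw [← Sum.inl.inj hx]; exact h
        · simp [φ, h] at hx
      · intro h
        exact ⟨z, by simp [φ, h]⟩
    · simp only [Finset.mem_image, Finset.mem_univ, true_and, Finset.inr_mem_disjSum]
      constructor
      · rintro ⟨x, hx⟩
        by_cases h : f x = x
        · simp [φ, h] at hx
        · simp only [φ, if_neg h] at hx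
          rw [← Sum.inr.inj hx, Perm.cycleOf_mem_cycleFactorsFinset_iff]
          exact Perm.mem_support.2 h
      · intro h
        obtain ⟨x, hx⟩ := (Perm.mem_cycleFactorsFinset_iff.1 h).1.nonempty_support
        have hc := Perm.cycle_is_cycleOf hx h
        have hx' : f x ≠ x := by
          rw [← Perm.mem_support]
          exact Perm.mem_cycleFactorsFinset_support_le h hx
        exact ⟨x, by simp [φ, hx', hc]⟩
  have h3 : (Finset.univ.filter (fun x => f x = x)).card + f.support.card = Fintype.card α := by
    have := Finset.card_filter_add_card_filter_not (s := (Finset.univ : Finset α)) (fun x => f x = x)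
    simpa [Perm.support] using this
  have h4 : Multiset.card f.cycleType = f.cycleFactorsFinset.card := by
    simp [Perm.cycleType_def]
  rw [h1, h2, Finset.card_disjSum, h4]
  omega

set_option linter.unusedSectionVars false

section Rank

variable {α : Type*} [Fintype α] [DecidableEq α]

/-- number of classes -/
noncomputable def ncl (s : Setoid α) : ℕ := Nat.card (Quotient s)

/-- Join two classes of a setoid. -/
def joinPair (s : Setoid α) (x y : α) : Setoid α where
  r u v := s u v ∨ (s u x ∧ s y v) ∨ (s u y ∧ s x v)
  iseqv := by
    refine ⟨fun _ => Or.inl (s.refl _), ?_, ?_⟩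
    · rintro u v (h | ⟨h, h'⟩ | ⟨h, h'⟩)
      · exact Or.inl (s.symm h)
      · exact Or.inr (Or.inr ⟨s.symm h', s.symm h⟩)
      · exact Or.inr (Or.inl ⟨s.symm h', s.symm h⟩)
    · intro u v w h1 h2
      rcases h1 with h1 | ⟨h1, h1'⟩ | ⟨h1, h1'⟩ <;> rcases h2 with h2 | ⟨h2, h2'⟩ | ⟨h2, h2'⟩
      · exact Or.inl (s.trans h1 h2)
      · exact Or.inr (Or.inl ⟨s.trans h1 h2, h2'⟩)
      · exact Or.inr (Or.inr ⟨s.trans h1 h2, h2'⟩)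
      · exact Or.inr (Or.inl ⟨h1, s.trans h1' h2⟩)
      · exact Or.inr (Or.inl ⟨h1, h2'⟩)
      · exact Or.inl (s.trans h1 h2')
      · exact Or.inr (Or.inr ⟨h1, s.trans h1' h2⟩)
      · exact Or.inl (s.trans h1 h2')
      · exact Or.inr (Or.inr ⟨h1, h2'⟩)

theorem le_joinPair (s : Setoid α) (x y : α) : s ≤ joinPair s x y := fun _ _ h => Or.inl h

theorem joinPair_rel (s : Setoid α) (x y : α) : joinPair s x y x y :=
  Or.inr (Or.inl ⟨s.refl _, s.refl _⟩)

theorem joinPair_le {s t : Setoid α} {x y : α} (h : s ≤ t) (hxy : t x y) : joinPair s x y ≤ t := by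
  rintro u v (h1 | ⟨h1, h2⟩ | ⟨h1, h2⟩)
  · exact h h1
  · exact t.trans (h h1) (t.trans hxy (h h2))
  · exact t.trans (h h1) (t.trans (t.symm hxy) (h h2))

theorem ncl_mono {s t : Setoid α} (h : s ≤ t) : ncl t ≤ ncl s := by
  classical
  refine Nat.card_le_card_of_surjective (Quotient.map' (s₁ := s) (s₂ := t) id (fun a b hab => h hab)) ?_
  intro q
  induction q using Quotient.inductionOn with
  | h a => exact ⟨Quotient.mk s a, rfl⟩

theorem ncl_joinPair_lt {s : Setoid α} {x y : α} (h : ¬ s x y) : ncl (joinPair s x y) < ncl s := by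
  classical
  refine lt_of_le_of_ne (ncl_mono (le_joinPair s x y)) ?_
  intro heq
  let g : Quotient s → Quotient (joinPair s x y) :=
    Quotient.map' (s₁ := s) (s₂ := joinPair s x y) id (fun a b hab => le_joinPair s x y hab)
  have hs : Function.Surjective g := by
    intro q
    induction q using Quotient.inductionOn with
    | h a => exact ⟨Quotient.mk s a, rfl⟩
  have hb : Function.Bijective g := by
    rw [Nat.bijective_iff_surjective_and_card]
    exact ⟨hs, heq.symm⟩
  have : Quotient.mk s x = Quotient.mk s y := by
    apply hb.1
    exact Quotient.sound (s := joinPair s x y) (joinPair_rel s x y)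
  exact h (Quotient.exact this)

theorem ncl_le_joinPair (s : Setoid α) (x y : α) : ncl s ≤ ncl (joinPair s x y) + 1 := by
  classical
  let g : Quotient s → Option (Quotient (joinPair s x y)) := fun q =>
    if q = Quotient.mk s y then none else
      some (Quotient.map' (s₁ := s) (s₂ := joinPair s x y) id (fun a b hab => le_joinPair s x y hab) q)
  have hg : Function.Injective g := by
    intro p q
    induction p using Quotient.inductionOn with
    | h a =>
    induction q using Quotient.inductionOn with
    | h b =>
    intro hab
    by_cases ha : Quotient.mk s a = Quotient.mk s y <;> by_cases hb : Quotient.mk s b = Quotient.mk s y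
    · rw [ha, hb]
    · simp [g, ha, hb] at hab
    · simp [g, ha, hb] at hab
    · simp only [g, if_neg ha, if_neg hb] at hab
      have h2 : joinPair s x y a b := Quotient.exact (Option.some.inj hab)
      rcases h2 with h2 | ⟨h2, h3⟩ | ⟨h2, h3⟩
      · exact Quotient.sound h2
      · exact absurd (Quotient.sound (s.symm h3)) hb
      · exact absurd (Quotient.sound h2) ha
  have := Nat.card_le_card_of_injective g hg
  rwa [Finite.card_option] at this

end Rank

section Len

open Equiv

variable {α : Type*} [Fintype α] [DecidableEq α]

/-- rank of a setoid -/
noncomputable def rk (s : Setoid α) : ℤ := (Fintype.card α : ℤ) - ncl s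

/-- reflection length of a permutation -/
noncomputable def len (π : Perm α) : ℤ := (Fintype.card α : ℤ) - numCycles π

theorem len_eq_rk (π : Perm α) : len π = rk (permSetoid π) := rfl

theorem permSetoid_le_iff {π : Perm α} {t : Setoid α} :
    permSetoid π ≤ t ↔ ∀ x, t x (π x) := by
  constructor
  · intro h x
    exact h (show π.SameCycle x (π x) from ⟨1, by simp⟩)
  · intro h x y hxy
    obtain ⟨i, hi⟩ := hxy
    have hn : ∀ (n : ℕ) x, t x ((π ^ n) x) := by
      intro n
      induction n with
      | zero => intro x; exact t.refl _
      | succ k ih =>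
        intro x
        rw [pow_succ', Perm.mul_apply]
        exact t.trans (ih x) (h _)
    rw [← hi]
    rcases i with n | n
    · simpa using hn n x
    · have := hn (n + 1) ((π ^ (Int.negSucc n)) x)
      rw [← Perm.mul_apply, zpow_negSucc, mul_inv_cancel, Perm.one_apply] at this
      rw [zpow_negSucc]
      exact t.symm this

theorem rel_swap {t : Setoid α} {x y : α} (h : t x y) (z : α) : t z (swap x y z) := by
  rcases eq_or_ne z x with rfl | hx
  · simpa using h
  rcases eq_or_ne z y with rfl | hy
  · simpa using t.symm h
  rw [swap_apply_of_ne_of_ne hx hy]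

theorem rel_inv {t : Setoid α} {π : Perm α} (h : ∀ x, t x (π x)) (x : α) : t x (π⁻¹ x) := by
  have := h (π⁻¹ x)
  rw [← Perm.mul_apply, mul_inv_cancel, Perm.one_apply] at this
  exact t.symm this

theorem rel_mul {t : Setoid α} {π ρ : Perm α} (h : ∀ x, t x (π x)) (h' : ∀ x, t x (ρ x)) (x : α) :
    t x ((π * ρ) x) := t.trans (h' x) (h _)

theorem permSetoid_rel (π : Perm α) (x : α) : permSetoid π x (π x) :=
  permSetoid_le_iff.1 le_rfl x

theorem permSetoid_mul_swap_le (π : Perm α) (x y : α) :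
    permSetoid (π * swap x y) ≤ joinPair (permSetoid π) x y := by
  rw [permSetoid_le_iff]
  apply rel_mul
  · intro z; exact le_joinPair _ _ _ (permSetoid_rel π z)
  · exact rel_swap (joinPair_rel _ _ _)

theorem len_mul_swap_ne (π : Perm α) {x y : α} (hxy : x ≠ y) : len (π * swap x y) ≠ len π := by
  intro h
  have h0 : numCycles (π * swap x y) = numCycles π := by
    unfold len at h; omega
  have h1 := numCycles_formula π
  have h2 := numCycles_formula (π * swap x y)
  have h3 : Perm.sign (π * swap x y) = - Perm.sign π := by
    rw [Perm.sign_mul, Perm.sign_swap hxy]; simp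
  rw [Perm.sign_of_cycleType, Perm.sign_of_cycleType, Perm.sum_cycleType, Perm.sum_cycleType] at h3
  rw [h0] at h2
  have h4 : (π * swap x y).support.card + Multiset.card (π * swap x y).cycleType =
    (Multiset.card (π * swap x y).cycleType) * 2 + Fintype.card α - numCycles π := by omega
  rcases Nat.even_or_odd ((π * swap x y).support.card + Multiset.card (π * swap x y).cycleType) with
    he | he <;> rcases Nat.even_or_odd (π.support.card + Multiset.card π.cycleType) with hf | hf
  · rw [he.neg_one_pow, hf.neg_one_pow] at h3
    exact absurd h3 (by decide)
  · rcases he with ⟨a, ha⟩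
    rcases hf with ⟨b, hb⟩
    omega
  · rcases he with ⟨a, ha⟩
    rcases hf with ⟨b, hb⟩
    omega
  · rw [he.neg_one_pow, hf.neg_one_pow] at h3
    exact absurd h3 (by decide)

theorem joinPair_mul_swap (π : Perm α) (x y : α) :
    joinPair (permSetoid (π * swap x y)) x y = joinPair (permSetoid π) x y := by
  apply le_antisymm
  · exact joinPair_le (permSetoid_mul_swap_le π x y) (joinPair_rel _ _ _)
  · apply joinPair_le _ (joinPair_rel _ _ _)
    have := permSetoid_mul_swap_le (π * swap x y) x y
    rwa [mul_assoc, swap_mul_self, mul_one] at this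

theorem len_mul_swap_of_not (π : Perm α) {x y : α} (h : ¬ permSetoid π x y) :
    len (π * swap x y) = len π + 1 := by
  have hxy : x ≠ y := by
    rintro rfl; exact h ((permSetoid π).refl x)
  have h1 := len_mul_swap_ne π hxy
  have h2 := ncl_joinPair_lt h
  have h3 := ncl_le_joinPair (permSetoid π) x y
  have h4 := ncl_le_joinPair (permSetoid (π * swap x y)) x y
  have h5 := ncl_mono (le_joinPair (permSetoid (π * swap x y)) x y)
  rw [joinPair_mul_swap] at h4 h5
  simp only [len_eq_rk, rk] at *
  omega

theorem len_mul_swap_of_rel (π : Perm α) {x y : α} (hxy : x ≠ y) (h : permSetoid π x y) :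
    len (π * swap x y) = len π - 1 := by
  have h1 := len_mul_swap_ne π hxy
  have hj : joinPair (permSetoid π) x y = permSetoid π :=
    le_antisymm (joinPair_le le_rfl h) (le_joinPair _ _ _)
  have h4 := ncl_le_joinPair (permSetoid (π * swap x y)) x y
  have h5 := ncl_mono (le_joinPair (permSetoid (π * swap x y)) x y)
  rw [joinPair_mul_swap, hj] at h4 h5
  simp only [len_eq_rk, rk] at *
  omega

theorem len_mul_swap_le (π : Perm α) (x y : α) : len (π * swap x y) ≤ len π + 1 := by
  rcases eq_or_ne x y with rfl | hxy
  · rw [swap_self]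
    show len (π * 1) ≤ _
    simp
  by_cases h : permSetoid π x y
  · rw [len_mul_swap_of_rel π hxy h]; omega
  · rw [len_mul_swap_of_not π h]

theorem len_mul_swap_ge (π : Perm α) (x y : α) : len π - 1 ≤ len (π * swap x y) := by
  have := len_mul_swap_le (π * swap x y) x y
  rw [mul_assoc, swap_mul_self, mul_one] at this
  omega

theorem permSetoid_inv (π : Perm α) : permSetoid π⁻¹ = permSetoid π := by
  ext x y
  exact Perm.sameCycle_inv

theorem len_inv (π : Perm α) : len π⁻¹ = len π := by
  rw [len_eq_rk, permSetoid_inv, len_eq_rk]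

theorem len_swap_mul_of_not (π : Perm α) {x y : α} (h : ¬ permSetoid π x y) :
    len (swap x y * π) = len π + 1 := by
  rw [← len_inv, mul_inv_rev, swap_inv, len_mul_swap_of_not, len_inv]
  rwa [permSetoid_inv]

theorem support_le_two_len (π : Perm α) : (π.support.card : ℤ) ≤ 2 * len π := by
  have h1 := numCycles_formula π
  have h2 : Multiset.card π.cycleType • 2 ≤ π.cycleType.sum :=
    Multiset.card_nsmul_le_sum fun _ h => Perm.two_le_of_mem_cycleType h
  rw [Perm.sum_cycleType, smul_eq_mul] at h2
  unfold len
  omega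

theorem len_nonneg (π : Perm α) : 0 ≤ len π := by
  have := support_le_two_len π
  omega

theorem len_one : len (1 : Perm α) = 0 := by
  have h1 := numCycles_formula (1 : Perm α)
  simp at h1
  unfold len
  omega

theorem eq_one_of_len (π : Perm α) (h : len π ≤ 0) : π = 1 := by
  have := support_le_two_len π
  have h1 : π.support.card = 0 := by omega
  simpa using h1

/-- Induction on permutations along a geodesic of swaps. -/
theorem len_induction {P : Perm α → Prop} (h1 : P 1)
    (hs : ∀ (g : Perm α) (x y : α), x ≠ y → permSetoid (g * swap x y) x y → 
      len (g * swap x y) = len g + 1 → P g → P (g * swap x y)) : ∀ g, P g := by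
  have key : ∀ (n : ℕ) (g : Perm α), len g ≤ n → P g := by
    intro n
    induction n with
    | zero =>
      intro g hg
      rw [eq_one_of_len g (by simpa using hg)]
      exact h1
    | succ k ih =>
      intro g hg
      by_cases hg1 : g = 1
      · rw [hg1]; exact h1
      obtain ⟨x, hx⟩ : ∃ x, g x ≠ x := by
        by_contra! hcon
        exact hg1 (Perm.ext hcon)
      have h2 := len_mul_swap_of_rel g (Ne.symm hx) (permSetoid_rel g x)
      have h3 : g = (g * swap x (g x)) * swap x (g x) := by
        rw [mul_assoc, swap_mul_self, mul_one]
      have h4 := hs (g * swap x (g x)) x (g x) (Ne.symm hx)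
      rw [← h3] at h4
      exact h4 (permSetoid_rel g x) (by omega) (ih _ (by push_cast at hg; omega))
  intro g
  exact key (len g).toNat g (by simp)

theorem len_mul_le (π g : Perm α) : len (π * g) ≤ len π + len g := by
  induction g using len_induction with
  | h1 => simp [len_one]
  | hs g x y hxy hr hl ih =>
    have := len_mul_swap_le (π * g) x y
    rw [← mul_assoc]
    omega

theorem len_conj (π ρ : Perm α) : len (ρ * π * ρ⁻¹) = len π := by
  have : numCycles (ρ * π * ρ⁻¹) = numCycles π := by
    have h1 := numCycles_formula π
    have h2 := numCycles_formula (ρ * π * ρ⁻¹)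
    rw [Perm.cycleType_conj, Perm.card_support_conj] at h2
    omega
  rw [len, this, len]

theorem good_step (s : Setoid α) (π : Perm α) (m : ℤ) (h1 : permSetoid π ≤ s)
    (h2 : 2 * rk s ≤ m + len π) (g : Perm α) :
    ∃ s', s ≤ s' ∧ permSetoid g ≤ s' ∧ permSetoid (π * g) ≤ s' ∧
      2 * rk s' ≤ m + len g + len (π * g) := by
  induction g using len_induction with
  | h1 =>
    refine ⟨s, le_rfl, ?_, by simpa using h1, by simpa [len_one] using h2⟩
    rw [permSetoid_le_iff]
    intro x; exact s.refl x
  | hs g x y hxy hr hl ih =>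
    obtain ⟨s', hs, hg, hp, hk⟩ := ih
    by_cases hx : s' x y
    · refine ⟨s', hs, ?_, ?_, ?_⟩
      · rw [permSetoid_le_iff] at *
        exact rel_mul hg (rel_swap hx)
      · rw [← mul_assoc]
        rw [permSetoid_le_iff] at *
        exact rel_mul hp (rel_swap hx)
      · have := len_mul_swap_ge (π * g) x y
        rw [← mul_assoc]
        omega
    · refine ⟨joinPair s' x y, hs.trans (le_joinPair _ _ _), ?_, ?_, ?_⟩
      · rw [permSetoid_le_iff] at *
        exact rel_mul (fun z => le_joinPair _ _ _ (hg z)) (rel_swap (joinPair_rel _ _ _))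
      · rw [← mul_assoc]
        rw [permSetoid_le_iff] at *
        exact rel_mul (fun z => le_joinPair _ _ _ (hp z)) (rel_swap (joinPair_rel _ _ _))
      · have := len_mul_swap_of_not (π * g) (fun h => hx (hp h))
        have h3 := ncl_le_joinPair s' x y
        rw [← mul_assoc]
        unfold rk at *
        omega

theorem rk_mono {s t : Setoid α} (h : s ≤ t) : rk s ≤ rk t := by
  have := ncl_mono h
  unfold rk; omega

theorem ncl_bot : ncl (⊥ : Setoid α) = Fintype.card α := by
  unfold ncl
  rw [← Nat.card_eq_fintype_card]
  symm
  apply Nat.card_congr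
  refine Equiv.ofBijective (Quotient.mk (⊥ : Setoid α)) ⟨?_, Quotient.mk_surjective⟩
  intro a b h
  exact Quotient.exact h

/-- white-vertex components of a coloured graph -/
def colSetoid {ι : Type*} (σ : ι → Perm α) : Setoid α :=
  sInf {t | ∀ a b x, t x (((σ a)⁻¹ * σ b) x)}

theorem colSetoid_le {ι : Type*} {σ : ι → Perm α} {t : Setoid α}
    (h : ∀ a b x, t x (((σ a)⁻¹ * σ b) x)) : colSetoid σ ≤ t := sInf_le h

theorem colSetoid_rel {ι : Type*} (σ : ι → Perm α) (a b : ι) (x : α) :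
    colSetoid σ x (((σ a)⁻¹ * σ b) x) := by
  intro t ht
  exact ht a b x

theorem tour_nat (τ : ℕ → Perm α) (k : ℕ) :
    ∃ s : Setoid α, (∀ i < k, permSetoid ((τ i)⁻¹ * τ (i + 1)) ≤ s) ∧
      permSetoid ((τ 0)⁻¹ * τ k) ≤ s ∧
      2 * rk s ≤ ∑ i ∈ Finset.range k, len ((τ i)⁻¹ * τ (i + 1)) + len ((τ 0)⁻¹ * τ k) := by
  induction k with
  | zero =>
    refine ⟨⊥, by simp, ?_, ?_⟩
    · rw [permSetoid_le_iff]; intro x; simp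
    · simp [rk, ncl_bot, len_one]
  | succ k ih =>
    obtain ⟨s, h1, h2, h3⟩ := ih
    obtain ⟨s', h4, h5, h6, h7⟩ := good_step s _ _ h2 h3 ((τ k)⁻¹ * τ (k + 1))
    have he : (τ 0)⁻¹ * τ k * ((τ k)⁻¹ * τ (k + 1)) = (τ 0)⁻¹ * τ (k + 1) := by group
    rw [he] at h6 h7
    refine ⟨s', ?_, h6, ?_⟩
    · intro i hi
      rcases Nat.lt_succ_iff_lt_or_eq.1 hi with hi | rfl
      · exact (h1 i hi).trans h4
      · exact h5
    · rw [Finset.sum_range_succ]; exact h7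

theorem tour_ineq {d : ℕ} (τ : Fin (d + 1) → Perm α) :
    2 * rk (colSetoid τ) ≤ ∑ i : Fin (d + 1), len ((τ i)⁻¹ * τ (i + 1)) := by
  let τ' : ℕ → Perm α := fun i => τ (Fin.ofNat (d + 1) i)
  obtain ⟨s, h1, h2, h3⟩ := tour_nat τ' d
  have h4 : ∀ i ≤ d, ∀ x, s x (((τ' 0)⁻¹ * τ' i) x) := by
    intro i
    induction i with
    | zero => intro _ x; simp
    | succ k ih =>
      intro hk
      have he : (τ' 0)⁻¹ * τ' k * ((τ' k)⁻¹ * τ' (k + 1)) = (τ' 0)⁻¹ * τ' (k + 1) := by group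
      rw [← he]
      exact rel_mul (ih (by omega)) (permSetoid_le_iff.1 (h1 k (by omega)))
  have h5 : ∀ a : Fin (d + 1), τ' a.val = τ a := by
    intro a
    simp [τ']
  have h6 : colSetoid τ ≤ s := by
    apply colSetoid_le
    intro a b
    have he : (τ a)⁻¹ * τ b = ((τ' 0)⁻¹ * τ a)⁻¹ * ((τ' 0)⁻¹ * τ b) := by group
    rw [he]
    apply rel_mul
    · apply rel_inv
      rw [← h5 a]
      exact h4 _ (by omega)
    · rw [← h5 b]
      exact h4 _ (by omega)
  have h7 := rk_mono h6
  have h8 : ∑ i : Fin (d + 1), len ((τ i)⁻¹ * τ (i + 1)) =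
      ∑ i ∈ Finset.range d, len ((τ' i)⁻¹ * τ' (i + 1)) + len ((τ' 0)⁻¹ * τ' d) := by
    rw [Fin.sum_univ_castSucc, ← Fin.sum_univ_eq_sum_range (fun i => len ((τ' i)⁻¹ * τ' (i + 1)))]
    congr 1
    · apply Finset.sum_congr rfl
      intro i _
      have e1 := h5 i.castSucc
      have e2 := h5 (i.castSucc + 1)
      simp at e1 e2
      rw [Fin.coeSucc_eq_succ, e1, e2]
    · have e1 := h5 (Fin.last d)
      have e2 := h5 0
      simp at e1 e2
      rw [e1, e2, Fin.last_add_one, ← len_inv]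
      simp
  omega

end Len

section Avg

open Equiv

theorem avg_tours {d : ℕ} (hd : 1 ≤ d) (f : Fin (d + 1) → Fin (d + 1) → ℤ) (hf : ∀ a, f a a = 0) :
    (d : ℤ) * ∑ p : Perm (Fin (d + 1)), ∑ i, f (p i) (p (i + 1)) =
      ∑ _p : Perm (Fin (d + 1)), ∑ a, ∑ b, f a b := by
  have h1 : ∀ p : Perm (Fin (d + 1)), ∑ a, ∑ b, f a b = ∑ i, ∑ j, f (p i) (p j) := by
    intro p
    rw [← Equiv.sum_comp p (fun a => ∑ b, f a b)]
    refine Finset.sum_congr rfl fun i _ => ?_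
    rw [← Equiv.sum_comp p (fun b => f (p i) b)]
  have hne : ∀ i : Fin (d + 1), i ≠ i + 1 := by
    intro i h
    have h2 : (1 : Fin (d + 1)) = 0 := by
      have := congrArg (fun z => z - i) h
      simpa using this.symm
    have h3 := congrArg Fin.val h2
    rw [Fin.val_one', Fin.val_zero, Nat.mod_eq_of_lt (by omega)] at h3
    omega
  have h2 : ∀ i j : Fin (d + 1), i ≠ j → ∑ p : Perm (Fin (d + 1)), f (p i) (p j) =
      ∑ p : Perm (Fin (d + 1)), f (p i) (p (i + 1)) := by
    intro i j hij
    rw [← Equiv.sum_comp (Equiv.mulRight (swap j (i + 1)))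
      (fun p : Perm (Fin (d + 1)) => f (p i) (p (i + 1)))]
    refine Finset.sum_congr rfl fun p _ => ?_
    simp only [Equiv.coe_mulRight, Perm.mul_apply, swap_apply_right]
    rw [swap_apply_of_ne_of_ne hij (hne i)]
  have h3 : ∑ _p : Perm (Fin (d + 1)), ∑ a, ∑ b, f a b =
      ∑ i, ∑ j, ∑ p : Perm (Fin (d + 1)), f (p i) (p j) := by
    calc _ = ∑ p : Perm (Fin (d + 1)), ∑ i, ∑ j, f (p i) (p j) :=
          Finset.sum_congr rfl (fun p _ => h1 p)
      _ = _ := by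
          rw [Finset.sum_comm]
          exact Finset.sum_congr rfl (fun i _ => Finset.sum_comm)
  rw [h3, Finset.sum_comm, Finset.mul_sum]
  refine Finset.sum_congr rfl fun i _ => ?_
  rw [← Finset.add_sum_erase _ _ (Finset.mem_univ i)]
  rw [Finset.sum_congr rfl (fun j hj => h2 i j (Finset.ne_of_mem_erase hj).symm)]
  simp [hf]

theorem exists_separated {d : ℕ} (B : Finset (Fin (d + 1))) (hB : 2 * B.card ≤ d + 1) :
    ∃ p : Perm (Fin (d + 1)), ∀ i, p i ∈ B → p (i + 1) ∉ B := by
  classical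
  let S : Finset (Fin (d + 1)) := Finset.univ.filter (fun i => i.val % 2 = 0 ∧ i.val < 2 * B.card)
  have hS : S.card = B.card := by
    have : S = (Finset.univ : Finset (Fin B.card)).image
        (fun k => (⟨2 * k.val, by have := k.2; omega⟩ : Fin (d + 1))) := by
      ext i
      simp only [S, Finset.mem_filter, Finset.mem_univ, true_and, Finset.mem_image]
      constructor
      · rintro ⟨h1, h2⟩
        exact ⟨⟨i.val / 2, by omega⟩, Fin.ext (by simp; omega)⟩
      · rintro ⟨k, rfl⟩
        have := k.2
        simp
    rw [this, Finset.card_image_of_injective]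
    · simp
    · intro a b h
      simp at h
      exact Fin.ext h
  let e : {x // x ∈ S} ≃ {x // x ∈ B} := Finset.equivOfCardEq hS
  have hiff : ∀ i, e.extendSubtype i ∈ B ↔ i ∈ S := by
    intro i
    constructor
    · intro h
      by_contra hi
      exact e.extendSubtype_not_mem i hi h
    · exact e.extendSubtype_mem i
  refine ⟨e.extendSubtype, fun i hi => ?_⟩
  rw [hiff] at hi ⊢
  simp only [S, Finset.mem_filter, Finset.mem_univ, true_and] at hi ⊢
  rcases Nat.lt_or_ge i.val d with h | h
  · have : (i + 1).val = i.val + 1 := Fin.val_add_one_of_lt (by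
      rw [Fin.lt_def]; simpa using h)
    omega
  · have := i.2
    omega

theorem sum_sym {k : ℕ} (f : Fin k → Fin k → ℤ) (hf : ∀ a, f a a = 0) (hs : ∀ a b, f a b = f b a) :
    ∑ a, ∑ b, f a b =
      2 * ∑ p ∈ Finset.univ.filter (fun p : Fin k × Fin k => p.1 < p.2), f p.1 p.2 := by
  rw [← Finset.univ_product_univ, ← Finset.sum_product']
  rw [Finset.sum_filter, two_mul]
  have h1 : ∑ p ∈ (Finset.univ : Finset (Fin k)) ×ˢ (Finset.univ : Finset (Fin k)),
      (if p.1 < p.2 then f p.1 p.2 else 0) =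
      ∑ p ∈ (Finset.univ : Finset (Fin k)) ×ˢ (Finset.univ : Finset (Fin k)),
      (if p.2 < p.1 then f p.1 p.2 else 0) := by
    rw [Finset.univ_product_univ,
      ← Equiv.sum_comp (Equiv.prodComm (Fin k) (Fin k))]
    refine Finset.sum_congr rfl fun p _ => ?_
    by_cases h : p.2 < p.1
    · have h' : (Equiv.prodComm (Fin k) (Fin k) p).1 < (Equiv.prodComm (Fin k) (Fin k) p).2 := h
      rw [if_pos h, if_pos h']
      exact hs _ _
    · have h' : ¬ (Equiv.prodComm (Fin k) (Fin k) p).1 < (Equiv.prodComm (Fin k) (Fin k) p).2 := h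
      rw [if_neg h, if_neg h']
  nth_rw 2 [h1]
  rw [← Finset.sum_add_distrib]
  refine Finset.sum_congr rfl fun p _ => ?_
  rcases lt_trichotomy p.1 p.2 with h | h | h
  · simp [h, h.not_gt]
  · rw [h]; simp [hf]
  · simp [h, h.not_gt]

variable {α : Type*} [Fintype α] [DecidableEq α]

/-- total distance -/
noncomputable def totLen {ι : Type*} [Fintype ι] (σ : ι → Perm α) : ℤ :=
  ∑ a, ∑ b, len ((σ a)⁻¹ * σ b)

theorem tour_ineq' {d : ℕ} (σ : Fin (d + 1) → Perm α) (p : Perm (Fin (d + 1))) :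
    2 * rk (colSetoid σ) ≤ ∑ i : Fin (d + 1), len ((σ (p i))⁻¹ * σ (p (i + 1))) := by
  have h := tour_ineq (fun i => σ (p i))
  have h2 : colSetoid σ ≤ colSetoid (fun i => σ (p i)) := by
    apply colSetoid_le
    intro a b x
    have := colSetoid_rel (fun i => σ (p i)) (p.symm a) (p.symm b) x
    simpa using this
  have := rk_mono h2
  omega

theorem totLen_ge {d : ℕ} (hd : 1 ≤ d) (σ : Fin (d + 1) → Perm α) :
    2 * d * rk (colSetoid σ) ≤ totLen σ := by
  have h := avg_tours hd (fun a b => len ((σ a)⁻¹ * σ b)) (by simp [len_one])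
  have h2 : ∑ _p : Perm (Fin (d + 1)), 2 * rk (colSetoid σ) ≤
      ∑ p : Perm (Fin (d + 1)), ∑ i : Fin (d + 1), len ((σ (p i))⁻¹ * σ (p (i + 1))) :=
    Finset.sum_le_sum fun p _ => tour_ineq' σ p
  have h3 := mul_le_mul_of_nonneg_left h2 (Int.natCast_nonneg d)
  rw [h, Finset.sum_const, Finset.sum_const, nsmul_eq_mul, nsmul_eq_mul] at h3
  have hpos : (0 : ℤ) < ((Finset.univ : Finset (Perm (Fin (d + 1)))).card : ℤ) := by
    exact_mod_cast Finset.card_pos.2 ⟨1, Finset.mem_univ _⟩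
  have h4 : ((Finset.univ : Finset (Perm (Fin (d + 1)))).card : ℤ) * (2 * d * rk (colSetoid σ)) ≤
    ((Finset.univ : Finset (Perm (Fin (d + 1)))).card : ℤ) * totLen σ := by
    unfold totLen
    linarith
  exact le_of_mul_le_mul_left h4 hpos

theorem tour_eq {d : ℕ} (hd : 1 ≤ d) (σ : Fin (d + 1) → Perm α)
    (hT : totLen σ ≤ 2 * d * rk (colSetoid σ)) (p : Perm (Fin (d + 1))) :
    ∑ i : Fin (d + 1), len ((σ (p i))⁻¹ * σ (p (i + 1))) = 2 * rk (colSetoid σ) := by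
  by_contra hne
  have hlt := lt_of_le_of_ne (tour_ineq' σ p) (Ne.symm hne)
  have h := avg_tours hd (fun a b => len ((σ a)⁻¹ * σ b)) (by simp [len_one])
  have h2 : ∑ _p : Perm (Fin (d + 1)), 2 * rk (colSetoid σ) <
      ∑ p : Perm (Fin (d + 1)), ∑ i : Fin (d + 1), len ((σ (p i))⁻¹ * σ (p (i + 1))) :=
    Finset.sum_lt_sum (fun p _ => tour_ineq' σ p) ⟨p, Finset.mem_univ _, hlt⟩
  have h3 := mul_lt_mul_of_pos_left h2 (show (0 : ℤ) < d by exact_mod_cast hd)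
  rw [h, Finset.sum_const, Finset.sum_const, nsmul_eq_mul, nsmul_eq_mul] at h3
  have hpos : (0 : ℤ) < ((Finset.univ : Finset (Perm (Fin (d + 1)))).card : ℤ) := by
    exact_mod_cast Finset.card_pos.2 ⟨1, Finset.mem_univ _⟩
  have h4 := mul_le_mul_of_nonneg_left hT hpos.le
  unfold totLen at h4
  linarith

/-- Existence of a white vertex at which one black neighbour carries at least half the colours. -/
theorem exists_vertex {d : ℕ} (hd : 3 ≤ d) (σ : Fin (d + 1) → Perm α)
    (hT : totLen σ ≤ 2 * d * rk (colSetoid σ)) (hne : ∃ w a b, σ a w ≠ σ b w) :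
    ∃ w a, 1 ≤ (Finset.univ.filter (fun c => σ c w ≠ σ a w)).card ∧
      2 * (Finset.univ.filter (fun c => σ c w ≠ σ a w)).card ≤ d + 1 := by
  classical
  let N : Finset α := Finset.univ.filter (fun w => ∃ a b, σ a w ≠ σ b w)
  obtain ⟨w0, a0, b0, hw0⟩ := hne
  have hw0N : w0 ∈ N := by simp only [N, Finset.mem_filter, Finset.mem_univ, true_and]; exact ⟨a0, b0, hw0⟩
  have hr : rk (colSetoid σ) + 1 ≤ N.card := by
    let t : Setoid α := Setoid.ker (fun x => if x ∈ N then none else some x)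
    have ht : colSetoid σ ≤ t := by
      apply colSetoid_le
      have key : ∀ a b x, x ∉ N → ((σ a)⁻¹ * σ b) x = x := by
        intro a b x hx
        simp only [N, Finset.mem_filter, Finset.mem_univ, true_and, not_exists, not_not] at hx
        rw [Perm.mul_apply, hx b a]; simp
      intro a b x
      by_cases hx : x ∈ N
      · by_cases hy : ((σ a)⁻¹ * σ b) x ∈ N
        · show (if x ∈ N then none else some x) = (if ((σ a)⁻¹ * σ b) x ∈ N then none else some _)
          rw [if_pos hx, if_pos hy]
        · exfalso
          have h1 := key b a _ hy
          rw [← Perm.mul_apply] at h1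
          have h2 : (σ b)⁻¹ * σ a * ((σ a)⁻¹ * σ b) = 1 := by group
          rw [h2] at h1
          rw [← h1] at hy
          exact hy hx
      · rw [key a b x hx]
    have h1 := ncl_mono ht
    have h2 : Fintype.card α - N.card + 1 ≤ ncl t := by
      have h3 : (insert none (Nᶜ.image some)).card ≤ ncl t := by
        unfold ncl
        rw [Nat.card_congr (Setoid.quotientKerEquivRange _), Nat.card_coe_set_eq, ← Set.ncard_coe_finset]
        apply Set.ncard_le_ncard _ (Set.toFinite _)
        intro z hz
        simp only [Finset.coe_insert, Set.mem_insert_iff, Finset.mem_coe, Finset.mem_image,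
          Finset.mem_compl] at hz
        rcases hz with rfl | ⟨x, hx, rfl⟩
        · exact ⟨w0, by simp [hw0N]⟩
        · exact ⟨x, by simp [hx]⟩
      rw [Finset.card_insert_of_notMem (by simp),
        Finset.card_image_of_injective _ (Option.some_injective α), Finset.card_compl] at h3
      exact h3
    have h3 := Finset.card_le_univ N
    unfold rk
    omega
  let E : α → ℤ := fun w => ∑ a, ∑ b, if σ a w ≠ σ b w then 1 else 0
  have hE : ∑ w, E w ≤ 2 * totLen σ := by
    simp only [E]
    rw [Finset.sum_comm]
    unfold totLen
    rw [Finset.mul_sum]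
    refine Finset.sum_le_sum fun a _ => ?_
    rw [Finset.sum_comm, Finset.mul_sum]
    refine Finset.sum_le_sum fun b _ => ?_
    refine le_trans (le_of_eq ?_) (support_le_two_len ((σ a)⁻¹ * σ b))
    rw [Finset.sum_boole]
    congr 2
    ext x
    simp only [Finset.mem_filter, Finset.mem_univ, true_and, Perm.mem_support, Perm.mul_apply, ne_eq,
      Perm.inv_eq_iff_eq]
    rw [not_iff_not]; exact eq_comm
  have hE0 : ∀ w, 0 ≤ E w := fun w => Finset.sum_nonneg fun a _ => Finset.sum_nonneg fun b _ => by
    split_ifs <;> simp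
  obtain ⟨w, hwN, hw⟩ : ∃ w ∈ N, E w < 4 * d := by
    apply Finset.exists_lt_of_sum_lt
    have h1 : ∑ w ∈ N, E w ≤ ∑ w, E w :=
      Finset.sum_le_sum_of_subset_of_nonneg (Finset.subset_univ _) (fun w _ _ => hE0 w)
    rw [Finset.sum_const, nsmul_eq_mul]
    have hd' : (0 : ℤ) < d := by exact_mod_cast (by omega : 0 < d)
    nlinarith
  obtain ⟨q, hq⟩ : ∃ q, E w = 2 * q := ⟨_, sum_sym _ (by simp) (by
    intro a b; simp only [ne_eq, eq_comm])⟩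
  let m : Fin (d + 1) → ℕ := fun a => (Finset.univ.filter (fun c => σ c w ≠ σ a w)).card
  have hm : ∑ a, (m a : ℤ) = E w := by
    simp only [E]
    refine Finset.sum_congr rfl fun a _ => ?_
    rw [Finset.sum_boole]
    simp only [m, ne_eq, eq_comm]
  obtain ⟨a, -, ha⟩ : ∃ a ∈ (Finset.univ : Finset (Fin (d + 1))),
      (d + 1 : ℤ) * m a ≤ 4 * d - 2 := by
    apply Finset.exists_le_of_sum_le (Finset.univ_nonempty)
    rw [← Finset.mul_sum, hm, Finset.sum_const, nsmul_eq_mul]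
    simp only [Finset.card_univ, Fintype.card_fin]
    push_cast
    have : E w ≤ 4 * d - 2 := by omega
    nlinarith
  refine ⟨w, a, ?_, ?_⟩
  · rw [Nat.one_le_iff_ne_zero]
    intro h0
    rw [Finset.card_eq_zero, Finset.filter_eq_empty_iff] at h0
    simp only [N, Finset.mem_filter, Finset.mem_univ, true_and] at hwN
    obtain ⟨b, c, hbc⟩ := hwN
    have h1 := h0 (Finset.mem_univ b)
    have h2 := h0 (Finset.mem_univ c)
    rw [not_not] at h1 h2
    exact hbc (h1.trans h2.symm)
  · show 2 * m a ≤ d + 1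
    have hm3 : m a ≤ 3 := by
      by_contra! h
      have : (4 : ℤ) ≤ m a := by exact_mod_cast h
      nlinarith
    generalize m a = k at ha hm3
    interval_cases k <;> push_cast at ha <;> omega

end Avg

section Median

open Equiv

variable {α : Type*} [Fintype α] [DecidableEq α]

theorem rk_nonneg (s : Setoid α) : 0 ≤ rk s := by
  have h := rk_mono (bot_le : ⊥ ≤ s)
  have h2 : rk (⊥ : Setoid α) = 0 := by simp [rk, ncl_bot]
  omega

theorem join_many {ι : Type*} [DecidableEq ι] (s : Setoid α) (w : α) (v : ι → α) (F : Finset ι) :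
    ∃ t, s ≤ t ∧ (∀ c ∈ F, t w (v c)) ∧ rk t ≤ rk s + F.card := by
  induction F using Finset.induction_on with
  | empty => exact ⟨s, le_rfl, by simp, by simp⟩
  | insert c F hc ih =>
    obtain ⟨t, h1, h2, h3⟩ := ih
    refine ⟨joinPair t w (v c), h1.trans (le_joinPair _ _ _), ?_, ?_⟩
    · intro e he
      rcases Finset.mem_insert.1 he with rfl | he
      · exact joinPair_rel _ _ _
      · exact le_joinPair _ _ _ (h2 e he)
    · rw [Finset.card_insert_of_notMem hc]
      have := ncl_le_joinPair t w (v c)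
      unfold rk at *
      push_cast
      omega

theorem reduce {d : ℕ} (hd : 3 ≤ d) (σ : Fin (d + 1) → Perm α)
    (hT : totLen σ ≤ 2 * d * rk (colSetoid σ)) (hne : ∃ w a b, σ a w ≠ σ b w) :
    ∃ (σ' : Fin (d + 1) → Perm α) (m : ℕ), 1 ≤ m ∧
      rk (colSetoid σ') = rk (colSetoid σ) - m ∧
      totLen σ' ≤ 2 * d * rk (colSetoid σ') ∧
      ∀ μ : Perm α, ∑ c, len (μ⁻¹ * σ c) ≤ ∑ c, len (μ⁻¹ * σ' c) + m := by
  classical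
  obtain ⟨w, a, hm1, hm2⟩ := exists_vertex hd σ hT hne
  set B := Finset.univ.filter (fun c => σ c w ≠ σ a w) with hB
  have hmemB : ∀ c, c ∈ B ↔ σ c w ≠ σ a w := by intro c; simp [hB]
  let v : Fin (d + 1) → α := fun c => (σ c)⁻¹ (σ a w)
  have hvσ : ∀ c, σ c (v c) = σ a w := by intro c; simp [v]
  have hv : ∀ c, c ∈ B ↔ v c ≠ w := by
    intro c
    rw [hmemB, not_iff_not]
    constructor
    · intro h
      apply (σ c).injective
      rw [hvσ, h]
    · intro h
      rw [← hvσ c, h]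
  let σ' : Fin (d + 1) → Perm α := fun c => σ c * swap w (v c)
  have hσ : ∀ c, σ c = σ' c * swap w (v c) := by
    intro c; simp only [σ']; rw [mul_assoc, swap_mul_self, mul_one]
  have hσnB : ∀ c, c ∉ B → σ' c = σ c := by
    intro c hc
    have : v c = w := by
      by_contra h; exact hc ((hv c).2 h)
    simp only [σ', this, swap_self]
    exact mul_one _
  -- lengths between a colour outside `B` and one inside
  have hlen1 : ∀ x y, x ∉ B → y ∈ B →
      len ((σ' x)⁻¹ * σ' y) = len ((σ x)⁻¹ * σ y) - 1 := by
    intro x y hx hy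
    rw [hσnB x hx]
    show len ((σ x)⁻¹ * (σ y * swap w (v y))) = _
    rw [← mul_assoc]
    apply len_mul_swap_of_rel _ ((hv y).1 hy).symm
    have h1 := permSetoid_rel ((σ x)⁻¹ * σ y) (v y)
    have h2 : ((σ x)⁻¹ * σ y) (v y) = w := by
      rw [Perm.mul_apply, hvσ y]
      have : σ x w = σ a w := by
        by_contra h; exact hx ((hmemB x).2 h)
      rw [← this]; simp
    rw [h2] at h1
    exact (permSetoid _).symm h1
  have hsymm : ∀ (τ : Fin (d + 1) → Perm α) x y, len ((τ x)⁻¹ * τ y) = len ((τ y)⁻¹ * τ x) := by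
    intro τ x y
    rw [← len_inv]; simp
  let I : Fin (d + 1) → ℤ := fun c => if c ∈ B then 1 else 0
  have hsumI : ∑ c, I c = B.card := by
    simp [I]
  have hlen2 : ∀ x y, ¬ (x ∈ B ∧ y ∈ B) →
      len ((σ' x)⁻¹ * σ' y) + I x + I y = len ((σ x)⁻¹ * σ y) := by
    intro x y hxy
    by_cases hx : x ∈ B <;> by_cases hy : y ∈ B
    · exact absurd ⟨hx, hy⟩ hxy
    · have := hlen1 y x hy hx
      rw [hsymm σ', hsymm σ, this]
      simp [I, hx, hy]
    · have := hlen1 x y hx hy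
      rw [this]
      simp [I, hx, hy]
    · rw [hσnB x hx, hσnB y hy]
      simp [I, hx, hy]
  -- the rank drops by at least `m`
  have hrk1 : rk (colSetoid σ') ≤ rk (colSetoid σ) - B.card := by
    obtain ⟨p, hp⟩ := exists_separated B hm2
    have h1 := tour_ineq' σ' p
    have h2 := tour_eq (by omega) σ hT p
    have h3 : ∑ i : Fin (d + 1), len ((σ (p i))⁻¹ * σ (p (i + 1))) =
        ∑ i : Fin (d + 1), len ((σ' (p i))⁻¹ * σ' (p (i + 1))) + ∑ i, I (p i) + ∑ i, I (p (i + 1)) := by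
      rw [← Finset.sum_add_distrib, ← Finset.sum_add_distrib]
      refine Finset.sum_congr rfl fun i _ => ?_
      rw [hlen2]
      rintro ⟨h, h'⟩
      exact hp i h h'
    have h4 : ∑ i, I (p i) = B.card := by rw [← hsumI]; exact Equiv.sum_comp p I
    have h5 : ∑ i, I (p (i + 1)) = B.card := by
      rw [← h4]; exact Equiv.sum_comp (Equiv.addRight (1 : Fin (d + 1))) (fun i => I (p i))
    omega
  have hcover : ∀ t : Setoid α, colSetoid σ' ≤ t → (∀ c, t w (v c)) → colSetoid σ ≤ t := by
    intro t ht hc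
    apply colSetoid_le
    intro x y
    have : (σ x)⁻¹ * σ y = (swap w (v x) * ((σ' x)⁻¹ * σ' y)) * swap w (v y) := by
      rw [hσ x, hσ y, mul_inv_rev, swap_inv]; group
    rw [this]
    apply rel_mul _ (rel_swap (hc y))
    apply rel_mul (rel_swap (hc x))
    intro z
    exact ht (colSetoid_rel σ' x y z)
  have hvnB : ∀ c, c ∉ B → v c = w := by
    intro c hc
    by_contra h; exact hc ((hv c).2 h)
  have hrk2 : rk (colSetoid σ) ≤ rk (colSetoid σ') + B.card := by
    obtain ⟨t, h1, h2, h3⟩ := join_many (colSetoid σ') w v B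
    refine le_trans (rk_mono (hcover t h1 ?_)) h3
    intro c
    by_cases hc : c ∈ B
    · exact h2 c hc
    · rw [hvnB c hc]
  have hnot : ∀ i ∈ B, ∀ j ∈ B, i ≠ j → ¬ joinPair (colSetoid σ') w (v j) w (v i) := by
    intro i hi j hj hij hrel
    obtain ⟨t, h1, h2, h3⟩ := join_many (colSetoid σ') w v (B.erase i)
    have hjt : t w (v j) := h2 j (Finset.mem_erase.2 ⟨hij.symm, hj⟩)
    have hit : t w (v i) := joinPair_le h1 hjt hrel
    have h4 : colSetoid σ ≤ t := by
      apply hcover t h1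
      intro c
      by_cases hc : c ∈ B
      · by_cases hci : c = i
        · rw [hci]; exact hit
        · exact h2 c (Finset.mem_erase.2 ⟨hci, hc⟩)
      · rw [hvnB c hc]
    have h5 := rk_mono h4
    rw [Finset.card_erase_of_mem hi] at h3
    omega
  have hlen3 : ∀ i ∈ B, ∀ j ∈ B, i ≠ j →
      len ((σ' i)⁻¹ * σ' j) + 2 = len ((σ i)⁻¹ * σ j) := by
    intro i hi j hj hij
    have he : (σ i)⁻¹ * σ j = swap w (v i) * (((σ' i)⁻¹ * σ' j) * swap w (v j)) := by
      rw [hσ i, hσ j, mul_inv_rev, swap_inv]; group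
    have hp : permSetoid ((σ' i)⁻¹ * σ' j) ≤ colSetoid σ' := by
      rw [permSetoid_le_iff]; exact colSetoid_rel σ' i j
    have h1 : len (((σ' i)⁻¹ * σ' j) * swap w (v j)) = len ((σ' i)⁻¹ * σ' j) + 1 := by
      apply len_mul_swap_of_not
      intro h
      exact hnot j hj i hi hij.symm (le_joinPair _ _ _ (hp h))
    rw [he, len_swap_mul_of_not, h1]
    · ring
    · intro h
      apply hnot i hi j hj hij
      refine le_trans (permSetoid_mul_swap_le _ _ _) ?_ h
      exact joinPair_le (hp.trans (le_joinPair _ _ _)) (joinPair_rel _ _ _)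
  have hlen4 : ∀ x y, len ((σ' x)⁻¹ * σ' y) + I x + I y =
      len ((σ x)⁻¹ * σ y) + (if x = y then 2 * I x else 0) := by
    intro x y
    by_cases hxy : x = y
    · subst hxy
      simp [len_one]; ring
    · rw [if_neg hxy, add_zero]
      by_cases hB2 : x ∈ B ∧ y ∈ B
      · rw [← hlen3 x hB2.1 y hB2.2 hxy]
        simp [I, hB2.1, hB2.2]; ring
      · exact hlen2 x y hB2
  have htot : totLen σ' + 2 * d * B.card = totLen σ := by
    have h1 : ∑ x, ∑ y, (len ((σ' x)⁻¹ * σ' y) + I x + I y) =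
      ∑ x, ∑ y, (len ((σ x)⁻¹ * σ y) + (if x = y then 2 * I x else 0)) :=
      Finset.sum_congr rfl fun x _ => Finset.sum_congr rfl fun y _ => hlen4 x y
    simp only [Finset.sum_add_distrib, Finset.sum_const, Finset.sum_ite_eq, Finset.mem_univ, if_true,
      Finset.card_univ, Fintype.card_fin, nsmul_eq_mul, ← Finset.mul_sum, hsumI] at h1
    unfold totLen
    push_cast at h1
    linarith
  refine ⟨σ', B.card, hm1, by omega, ?_, ?_⟩
  · have : rk (colSetoid σ') = rk (colSetoid σ) - B.card := by omega
    rw [this]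
    linarith
  · intro μ
    rw [← hsumI, ← Finset.sum_add_distrib]
    refine Finset.sum_le_sum fun c _ => ?_
    by_cases hc : c ∈ B
    · have := len_mul_swap_le (μ⁻¹ * σ' c) w (v c)
      rw [mul_assoc, ← hσ c] at this
      simpa [I, hc] using this
    · rw [hσnB c hc]; simp [I, hc]

theorem exists_median {d : ℕ} (hd : 3 ≤ d) : ∀ (k : ℕ) (σ : Fin (d + 1) → Perm α),
    rk (colSetoid σ) ≤ k → totLen σ ≤ 2 * d * rk (colSetoid σ) →
    ∃ μ : Perm α, ∑ c, len (μ⁻¹ * σ c) ≤ rk (colSetoid σ) := by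
  intro k
  induction k with
  | zero =>
    intro σ hk hT
    by_cases hne : ∃ w a b, σ a w ≠ σ b w
    · obtain ⟨σ', m, h1, h2, h3, h4⟩ := reduce hd σ hT hne
      have := rk_nonneg (colSetoid σ')
      push_cast at hk
      omega
    · push Not at hne
      refine ⟨σ 0, ?_⟩
      have : ∀ c, σ c = σ 0 := fun c => Perm.ext fun w => hne w c 0
      rw [Finset.sum_eq_zero]
      · exact rk_nonneg _
      · intro c _
        rw [this c]; simp [len_one]
  | succ k ih =>
    intro σ hk hT
    by_cases hne : ∃ w a b, σ a w ≠ σ b w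
    · obtain ⟨σ', m, h1, h2, h3, h4⟩ := reduce hd σ hT hne
      obtain ⟨μ, hμ⟩ := ih σ' (by push_cast at hk; omega) h3
      exact ⟨μ, by have := h4 μ; omega⟩
    · push Not at hne
      refine ⟨σ 0, ?_⟩
      have : ∀ c, σ c = σ 0 := fun c => Perm.ext fun w => hne w c 0
      rw [Finset.sum_eq_zero]
      · exact rk_nonneg _
      · intro c _
        rw [this c]; simp [len_one]

end Median

section Mel

open Equiv

theorem liftPerm_castSucc {n : ℕ} (τ : Perm (Fin n)) (i : Fin n) :
    liftPerm τ i.castSucc = (τ i).castSucc := by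
  simp [liftPerm, Equiv.permCongr_apply]

theorem liftPerm_last {n : ℕ} (τ : Perm (Fin n)) : liftPerm τ (Fin.last n) = Fin.last n := by
  simp [liftPerm, Equiv.permCongr_apply]

theorem liftPerm_mul {n : ℕ} (τ ρ : Perm (Fin n)) : liftPerm (τ * ρ) = liftPerm τ * liftPerm ρ := by
  ext x
  refine Fin.lastCases ?_ (fun i => ?_) x
  · simp [liftPerm_last]
  · simp [liftPerm_castSucc]

theorem liftPerm_one {n : ℕ} : liftPerm (1 : Perm (Fin n)) = 1 := by
  ext x
  refine Fin.lastCases ?_ (fun i => ?_) x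
  · simp [liftPerm_last]
  · simp [liftPerm_castSucc]

theorem liftPerm_inv {n : ℕ} (τ : Perm (Fin n)) : liftPerm τ⁻¹ = (liftPerm τ)⁻¹ := by
  rw [eq_inv_iff_mul_eq_one, ← liftPerm_mul, inv_mul_cancel, liftPerm_one]

theorem liftPerm_swap {n : ℕ} (x y : Fin n) :
    liftPerm (swap x y) = swap x.castSucc y.castSucc := by
  ext z
  refine Fin.lastCases ?_ (fun i => ?_) z
  · rw [liftPerm_last, swap_apply_of_ne_of_ne] <;> exact (Fin.castSucc_lt_last _).ne'
  · rw [liftPerm_castSucc, swap_apply_def, swap_apply_def]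
    simp only [Fin.castSucc_inj]
    split_ifs <;> rfl

theorem exists_liftPerm {n : ℕ} (π : Perm (Fin (n + 1))) (h : π (Fin.last n) = Fin.last n) :
    ∃ τ, π = liftPerm τ := by
  have h' : π⁻¹ (Fin.last n) = Fin.last n := by
    rw [Perm.inv_eq_iff_eq, h]
  have hne : ∀ (ρ : Perm (Fin (n + 1))), ρ (Fin.last n) = Fin.last n →
      ∀ i : Fin n, ρ i.castSucc ≠ Fin.last n := by
    intro ρ hρ i hi
    rw [← hρ] at hi
    exact (Fin.castSucc_lt_last i).ne (ρ.injective hi)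
  let τ : Perm (Fin n) :=
    { toFun := fun i => (π i.castSucc).castPred (hne π h i)
      invFun := fun i => (π⁻¹ i.castSucc).castPred (hne _ h' i)
      left_inv := by intro i; simp
      right_inv := by intro i; simp }
  refine ⟨τ, ?_⟩
  ext x
  refine Fin.lastCases ?_ (fun i => ?_) x
  · rw [h, liftPerm_last]
  · rw [liftPerm_castSucc]; simp [τ]

theorem len_le_liftPerm {n : ℕ} (τ : Perm (Fin n)) : len τ ≤ len (liftPerm τ) := by
  have hle : permSetoid τ ≤ (permSetoid (liftPerm τ)).comap Fin.castSucc := by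
    rw [permSetoid_le_iff]
    intro x
    show permSetoid (liftPerm τ) x.castSucc (τ x).castSucc
    rw [← liftPerm_castSucc]
    exact permSetoid_rel _ _
  let g : Option (Quotient (permSetoid τ)) → Quotient (permSetoid (liftPerm τ)) := fun o =>
    o.elim (Quotient.mk _ (Fin.last n))
      (Quotient.map' (s₁ := permSetoid τ) (s₂ := permSetoid (liftPerm τ)) Fin.castSucc
        (fun a b hab => hle hab))
  have hg : Function.Surjective g := by
    intro q
    induction q using Quotient.inductionOn with
    | h a =>
      refine Fin.lastCases ?_ (fun i => ?_) a
      · exact ⟨none, rfl⟩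
      · exact ⟨some (Quotient.mk _ i), rfl⟩
  have := Nat.card_le_card_of_surjective g hg
  rw [Finite.card_option] at this
  simp only [len, numCycles, Fintype.card_fin]
  push_cast
  omega

theorem len_liftPerm_le {n : ℕ} (τ : Perm (Fin n)) : len (liftPerm τ) ≤ len τ := by
  induction τ using len_induction with
  | h1 => rw [liftPerm_one, len_one, len_one]
  | hs g x y hxy hr hl ih =>
    rw [liftPerm_mul, liftPerm_swap]
    have := len_mul_swap_le (liftPerm g) x.castSucc y.castSucc
    omega

theorem len_of_melonic {ι : Type*} [DecidableEq ι] [Fintype ι] {n : ℕ} {σ : ι → Perm (Fin n)}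
    (h : Melonic σ) : 1 ≤ n ∧ ∑ a, len (σ a) ≤ (n : ℤ) - 1 := by
  induction h with
  | base => simp [len_one]
  | @insert n σ c w h ih =>
    refine ⟨by omega, ?_⟩
    have h1 : ∀ a, len (if a = c then liftPerm (σ a) * swap (Fin.castSucc w) (Fin.last n)
        else liftPerm (σ a)) ≤ len (σ a) + (if a = c then 1 else 0) := by
      intro a
      have h2 := len_liftPerm_le (σ a)
      split_ifs
      · have := len_mul_swap_le (liftPerm (σ a)) w.castSucc (Fin.last n)
        omega
      · omega
    have h3 := Finset.sum_le_sum (s := Finset.univ) fun a _ => h1 a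
    rw [Finset.sum_add_distrib, Finset.sum_ite_eq' Finset.univ c (fun _ => (1 : ℤ))] at h3
    simp only [Finset.mem_univ, if_true] at h3
    push_cast
    linarith [ih.2]

theorem exists_leaf {ι : Type*} [DecidableEq ι] [Fintype ι] {n : ℕ} (s : ι → Perm (Fin (n + 2)))
    (hs : ∑ a, len (s a) ≤ n + 1)
    (hc : ∀ t : Setoid (Fin (n + 2)), (∀ a x, t x (s a x)) → ∀ x y, t x y) :
    ∃ w c, s c w ≠ w ∧ ∀ a, a ≠ c → s a w = w := by
  have h1 : ∑ w, ∑ a, (if s a w ≠ w then (1 : ℤ) else 0) ≤ 2 * (n + 1) := by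
    rw [Finset.sum_comm]
    refine le_trans (Finset.sum_le_sum (g := fun a => 2 * len (s a)) fun a _ => ?_) ?_
    · refine le_trans (le_of_eq ?_) (support_le_two_len (s a))
      rw [Finset.sum_boole]; rfl
    · rw [← Finset.mul_sum]; linarith
  obtain ⟨w, -, hw⟩ : ∃ w ∈ (Finset.univ : Finset (Fin (n + 2))),
      ∑ a, (if s a w ≠ w then (1 : ℤ) else 0) < 2 := by
    apply Finset.exists_lt_of_sum_lt
    simp only [Finset.sum_const, Finset.card_univ, Fintype.card_fin, nsmul_eq_mul]
    push_cast
    linarith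
  rw [Finset.sum_boole] at hw
  have hw1 : (Finset.univ.filter (fun a => s a w ≠ w)).card ≤ 1 := by
    have : (Finset.univ.filter (fun a => s a w ≠ w)).card < 2 := by exact_mod_cast hw
    omega
  have hex : ∃ c, s c w ≠ w := by
    by_contra! hcon
    let t : Setoid (Fin (n + 2)) := Setoid.ker (fun x => decide (x = w))
    have h2 := hc t (by
      intro a x
      show decide (x = w) = decide (s a x = w)
      rw [decide_eq_decide]
      constructor
      · rintro rfl; exact hcon a
      · intro h
        apply (s a).injective
        rw [h, hcon a])
    obtain ⟨y, hy⟩ := exists_ne w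
    have h3 : decide (y = w) = decide (w = w) := h2 y w
    simp [hy] at h3
  obtain ⟨c, hcw⟩ := hex
  refine ⟨w, c, hcw, fun a ha => ?_⟩
  by_contra hne
  exact ha (Finset.card_le_one.1 hw1 a (by simpa using hne) c (by simpa using hcw))

theorem melonic_of_len {ι : Type*} [DecidableEq ι] [Fintype ι] : ∀ (n : ℕ)
    (s : ι → Perm (Fin (n + 1))), ∑ a, len (s a) ≤ n →
    (∀ t : Setoid (Fin (n + 1)), (∀ a x, t x (s a x)) → ∀ x y, t x y) →
    ∃ ρ : Perm (Fin (n + 1)), Melonic (fun a => ρ * s a * ρ⁻¹) := by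
  intro n
  induction n with
  | zero =>
    intro s _ _
    refine ⟨1, ?_⟩
    have : (fun a => 1 * s a * 1⁻¹) = fun _ : ι => (1 : Perm (Fin 1)) := by
      funext a
      exact Equiv.ext fun x => Subsingleton.elim (α := Fin 1) _ _
    rw [this]
    exact Melonic.base
  | succ n ih =>
    intro s hs hc
    obtain ⟨w, c, hcw, hw⟩ := exists_leaf s (by push_cast at hs; exact hs) hc
    let ρ0 : Perm (Fin (n + 2)) := swap w (Fin.last (n + 1))
    let s1 : ι → Perm (Fin (n + 2)) := fun a => ρ0 * s a * ρ0⁻¹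
    have hρ : ρ0⁻¹ (Fin.last (n + 1)) = w := by simp [ρ0]
    have hρ' : ρ0 w = Fin.last (n + 1) := by simp [ρ0]
    have h1 : ∀ a, a ≠ c → s1 a (Fin.last (n + 1)) = Fin.last (n + 1) := by
      intro a ha
      simp only [s1, Perm.mul_apply]
      rw [hρ, hw a ha, hρ']
    have h1c : s1 c (Fin.last (n + 1)) ≠ Fin.last (n + 1) := by
      simp only [s1, Perm.mul_apply]
      rw [hρ, ← hρ']
      exact fun h => hcw (ρ0.injective h)
    let v1 := (s1 c)⁻¹ (Fin.last (n + 1))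
    have hv1 : s1 c v1 = Fin.last (n + 1) := by simp [v1]
    have hv1ne : v1 ≠ Fin.last (n + 1) := by
      intro h
      rw [h] at hv1
      exact h1c hv1
    obtain ⟨v, hv⟩ : ∃ v : Fin (n + 1), v.castSucc = v1 := ⟨v1.castPred hv1ne, by simp⟩
    let s2 : ι → Perm (Fin (n + 2)) := fun a =>
      if a = c then s1 a * swap v1 (Fin.last (n + 1)) else s1 a
    have h2 : ∀ a, s2 a (Fin.last (n + 1)) = Fin.last (n + 1) := by
      intro a
      by_cases ha : a = c
      · subst ha
        simp only [s2, if_true, Perm.mul_apply, swap_apply_right]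
        exact hv1
      · simp only [s2, if_neg ha]
        exact h1 a ha
    choose τ hτ using fun a => exists_liftPerm (s2 a) (h2 a)
    have hs1 : ∀ a, s1 a = if a = c then liftPerm (τ a) * swap v1 (Fin.last (n + 1))
        else liftPerm (τ a) := by
      intro a
      rw [← hτ]
      by_cases ha : a = c
      · subst ha
        simp only [s2, if_true]
        rw [mul_assoc, swap_mul_self, mul_one]
      · simp only [s2, if_neg ha]
    have hlen : ∀ a, len (τ a) + (if a = c then 1 else 0) ≤ len (s a) := by
      intro a
      have e1 := len_le_liftPerm (τ a)
      have e2 := len_conj (s a) ρ0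
      rw [← hτ] at e1
      by_cases ha : a = c
      · subst ha
        simp only [s2, if_true] at e1 ⊢
        have e3 : len (s1 a * swap v1 (Fin.last (n + 1))) = len (s1 a) - 1 := by
          apply len_mul_swap_of_rel _ hv1ne
          have := permSetoid_rel (s1 a) v1
          rwa [hv1] at this
        rw [e3] at e1
        simp only [s1] at e1
        omega
      · simp only [s2, if_neg ha] at e1 ⊢
        simp only [s1] at e1
        omega
    have hsum : ∑ a, len (τ a) ≤ n := by
      have h3 := Finset.sum_le_sum (s := Finset.univ) fun a _ => hlen a
      rw [Finset.sum_add_distrib, Finset.sum_ite_eq' Finset.univ c (fun _ => (1 : ℤ))] at h3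
      simp only [Finset.mem_univ, if_true] at h3
      push_cast at hs
      linarith
    have hconn : ∀ t : Setoid (Fin (n + 1)), (∀ a x, t x (τ a x)) → ∀ x y, t x y := by
      intro t ht
      let f : Fin (n + 2) → Fin (n + 1) := Fin.lastCases v (fun i => i)
      have fl : f (Fin.last (n + 1)) = v := by simp [f]
      have fc : ∀ i : Fin (n + 1), f i.castSucc = i := by intro i; simp [f]
      have hl : ∀ a x, t (f x) (f (liftPerm (τ a) x)) := by
        intro a x
        refine Fin.lastCases ?_ (fun i => ?_) x
        · rw [liftPerm_last]
        · rw [liftPerm_castSucc, fc, fc]; exact ht a i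
      have hs1t : ∀ a x, (t.comap f) x (s1 a x) := by
        intro a
        rw [hs1]
        split_ifs
        · apply rel_mul (hl a)
          apply rel_swap
          show t (f v1) (f (Fin.last (n + 1)))
          rw [← hv, fc, fl]
        · exact hl a
      have h4 := hc ((t.comap f).comap ρ0) (by
        intro a x
        show (t.comap f) (ρ0 x) (ρ0 (s a x))
        have := hs1t a (ρ0 x)
        simpa [s1] using this)
      intro x y
      have h5 : t (f (ρ0 (ρ0⁻¹ x.castSucc))) (f (ρ0 (ρ0⁻¹ y.castSucc))) :=
        h4 (ρ0⁻¹ x.castSucc) (ρ0⁻¹ y.castSucc)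
      simpa [fc] using h5
    obtain ⟨ρ, hmel⟩ := ih τ hsum hconn
    refine ⟨liftPerm ρ * ρ0, ?_⟩
    have hfin := Melonic.insert c (ρ v) hmel
    have heq : (fun a => liftPerm ρ * ρ0 * s a * (liftPerm ρ * ρ0)⁻¹) = fun a =>
        if a = c then liftPerm (ρ * τ a * ρ⁻¹) * swap (Fin.castSucc (ρ v)) (Fin.last (n + 1))
        else liftPerm (ρ * τ a * ρ⁻¹) := by
      funext a
      have e1 : liftPerm ρ * ρ0 * s a * (liftPerm ρ * ρ0)⁻¹ = liftPerm ρ * s1 a * (liftPerm ρ)⁻¹ := by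
        simp only [s1]; group
      rw [e1, hs1 a]
      split_ifs
      · have e2 : swap (Fin.castSucc (ρ v)) (Fin.last (n + 1)) =
            liftPerm ρ * swap v1 (Fin.last (n + 1)) * (liftPerm ρ)⁻¹ := by
          rw [← liftPerm_castSucc, hv]
          nth_rw 1 [← liftPerm_last ρ]
          rw [Equiv.swap_apply_apply]
        rw [e2, liftPerm_mul, liftPerm_mul, liftPerm_inv]
        group
      · rw [liftPerm_mul, liftPerm_mul, liftPerm_inv]
    rw [heq]
    exact hfin

theorem totLen_totalCycles {n d : ℕ} (σ : Fin (d + 1) → Perm (Fin n)) :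
    totLen σ + 2 * totalCycles σ = (d + 1) * d * n := by
  unfold totLen
  have hs : ∀ a b, len ((σ a)⁻¹ * σ b) = len ((σ b)⁻¹ * σ a) := by
    intro a b
    rw [← len_inv]; simp
  rw [sum_sym (fun a b => len ((σ a)⁻¹ * σ b)) (by simp [len_one]) hs]
  unfold totalCycles
  push_cast
  rw [← mul_add, ← Finset.sum_add_distrib]
  have h1 : ∀ p : Fin (d + 1) × Fin (d + 1), len ((σ p.1)⁻¹ * σ p.2) +
      (numCycles ((σ p.1)⁻¹ * σ p.2) : ℤ) = n := by
    intro p; simp [len]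
  rw [Finset.sum_congr rfl fun p _ => h1 p]
  have h2 := sum_sym (k := d + 1) (fun a b => if a = b then 0 else (n : ℤ)) (by simp)
    (by intro a b; simp only [eq_comm])
  have h3 : ∑ p ∈ Finset.univ.filter (fun p : Fin (d + 1) × Fin (d + 1) => p.1 < p.2),
      (if p.1 = p.2 then 0 else (n : ℤ)) =
      ∑ p ∈ Finset.univ.filter (fun p : Fin (d + 1) × Fin (d + 1) => p.1 < p.2), (n : ℤ) := by
    refine Finset.sum_congr rfl fun p hp => ?_
    rw [if_neg (Finset.mem_filter.1 hp).2.ne]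
  rw [h3] at h2
  rw [← h2]
  have h4 : ∀ a : Fin (d + 1), ∑ b : Fin (d + 1), (if a = b then 0 else (n : ℤ)) = d * n := by
    intro a
    have : ∀ b : Fin (d + 1), (if a = b then 0 else (n : ℤ)) = n - (if a = b then (n : ℤ) else 0) := by
      intro b; split_ifs <;> simp
    rw [Finset.sum_congr rfl fun b _ => this b, Finset.sum_sub_distrib]
    simp
    ring
  rw [Finset.sum_congr rfl fun a _ => h4 a]
  simp
  ring

theorem rel_of_connected {n d : ℕ} {σ : Fin (d + 1) → Perm (Fin n)} (hconn : ColoredConnected σ)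
    {t : Setoid (Fin n)} (ht : ∀ a b x, t x (((σ a)⁻¹ * σ b) x)) (x y : Fin n) : t x y := by
  obtain ⟨g, hg, rfl⟩ := hconn x y
  have : ∀ z, t z (g z) := by
    induction hg using Subgroup.closure_induction with
    | mem g hg =>
      obtain ⟨a, b, rfl⟩ := hg
      exact ht a b
    | one => intro z; exact t.refl _
    | mul g h _ _ h1 h2 => exact rel_mul h1 h2
    | inv g _ h1 => exact rel_inv h1
  exact this x

theorem rk_of_connected {n d : ℕ} (hn : 1 ≤ n) {σ : Fin (d + 1) → Perm (Fin n)}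
    (hconn : ColoredConnected σ) : rk (colSetoid σ) = n - 1 := by
  have h1 : ncl (colSetoid σ) = 1 := by
    unfold ncl
    rw [Nat.card_eq_one_iff_unique]
    constructor
    · constructor
      intro p q
      induction p using Quotient.inductionOn with
      | h a =>
      induction q using Quotient.inductionOn with
      | h b => exact Quotient.sound (rel_of_connected hconn (colSetoid_rel σ) a b)
    · exact ⟨Quotient.mk _ ⟨0, hn⟩⟩
  unfold rk
  rw [h1]
  simp

theorem totLen_le_of_len {ι : Type*} [DecidableEq ι] [Fintype ι] {n : ℕ} (s : ι → Perm (Fin n)) :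
    totLen s ≤ 2 * (Fintype.card ι - 1) * ∑ a, len (s a) := by
  unfold totLen
  have h1 : ∀ a b, len ((s a)⁻¹ * s b) ≤
      len (s a) + len (s b) - (if a = b then 2 * len (s a) else 0) := by
    intro a b
    by_cases hab : a = b
    · subst hab
      simp [len_one]
      linarith
    · have := len_mul_le (s a)⁻¹ (s b)
      rw [len_inv] at this
      simpa [hab] using this
  refine le_trans (Finset.sum_le_sum fun a _ => Finset.sum_le_sum fun b _ => h1 a b) (le_of_eq ?_)
  simp only [Finset.sum_sub_distrib, Finset.sum_add_distrib, Finset.sum_const, Finset.sum_ite_eq,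
    Finset.mem_univ, if_true, Finset.card_univ, nsmul_eq_mul, ← Finset.mul_sum]
  ring

end Mel

/-- **Characterization of the maximizers of the number of bicolored cycles**: for `d ≥ 3`, a
connected colored graph on `2n` vertices has vanishing Gurau degree, i.e.
`C(G) = d + d(d−1)·n/2` (stated as `2·C(G) = 2·d + d·(d−1)·n`), if and only if it is isomorphic,
by independent relabelings `ρw` of its white and `ρb` of its black vertices, to a melonic
colored graph. -/
theorem vanishing_degree_iff_melonic {d n : ℕ} (hd : 3 ≤ d) (hn : 1 ≤ n)
    (σ : Fin (d + 1) → Equiv.Perm (Fin n)) (hconn : ColoredConnected σ) :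
    2 * totalCycles σ = 2 * d + d * (d - 1) * n ↔
      ∃ ρw ρb : Equiv.Perm (Fin n), Melonic (fun c => ρb * σ c * ρw⁻¹) := by
  have hr := rk_of_connected hn hconn
  have hc := totLen_totalCycles σ
  have hge := totLen_ge (by omega) σ
  rw [hr] at hge
  have hiff : 2 * totalCycles σ = 2 * d + d * (d - 1) * n ↔ totLen σ ≤ 2 * d * ((n : ℤ) - 1) := by
    have hd1 : ((d - 1 : ℕ) : ℤ) = d - 1 := by
      rw [Nat.cast_sub (by omega)]; simp
    constructor
    · intro h
      have h' : (2 * totalCycles σ : ℤ) = 2 * d + d * (d - 1) * n := by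
        rw [← hd1]; exact_mod_cast h
      linarith
    · intro h
      have h' : (2 * totalCycles σ : ℤ) = 2 * d + d * (d - 1) * n := by
        linarith
      rw [← hd1] at h'
      exact_mod_cast h'
  rw [hiff]
  constructor
  · intro hT
    obtain ⟨μ, hμ⟩ := exists_median hd n σ (by rw [hr]; omega) (by rw [hr]; exact hT)
    rw [hr] at hμ
    obtain ⟨k, rfl⟩ : ∃ k, n = k + 1 := ⟨n - 1, by omega⟩
    obtain ⟨ρ, hρ⟩ := melonic_of_len k (fun c => μ⁻¹ * σ c) (by push_cast at hμ; linarith) (by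
      intro t ht
      apply rel_of_connected hconn
      intro a b
      have he : (σ a)⁻¹ * σ b = (μ⁻¹ * σ a)⁻¹ * (μ⁻¹ * σ b) := by group
      rw [he]
      exact rel_mul (rel_inv (ht a)) (ht b))
    refine ⟨ρ, ρ * μ⁻¹, ?_⟩
    have he : (fun c => ρ * μ⁻¹ * σ c * ρ⁻¹) = fun c => ρ * (μ⁻¹ * σ c) * ρ⁻¹ := by
      funext c; group
    rw [he]
    exact hρ
  · rintro ⟨ρw, ρb, hmel⟩
    have h1 := (len_of_melonic hmel).2
    have h2 := totLen_le_of_len (fun c => ρb * σ c * ρw⁻¹)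
    have h3 : totLen (fun c => ρb * σ c * ρw⁻¹) = totLen σ := by
      unfold totLen
      refine Finset.sum_congr rfl fun a _ => Finset.sum_congr rfl fun b _ => ?_
      rw [← len_conj ((σ a)⁻¹ * σ b) ρw]
      congr 1
      group
    rw [h3] at h2
    simp only [Fintype.card_fin] at h2
    push_cast at h2
    have hd0 : (0 : ℤ) ≤ 2 * d := by positivity
    have h4 := mul_le_mul_of_nonneg_left h1 hd0
    have h5 : (2 * ((d : ℤ) + 1 - 1)) = 2 * d := by ring
    rw [h5] at h2
    linarith
end

section
/- Edge-flip lemma (general formula): Let G = (σ_0, σ_1, …, σ_d) be a connected colored graph on 2n vertices and let v_1 ≠ v_2 be two white vertices (so the color-0 edges at v_1 and v_2 are distinct). Let G' = (σ_0 ∘ swap(v_1, v_2), σ_1, …, σ_d) be the graph obtained by flipping these two color-0 edges, and let I(v_1, v_2) = {c ∈ {1,…,d} : v_1 and v_2 lie in the same orbit of σ_c⁻¹ * σ_0}. If G' is connected, then C_0(G') = C_0(G) − d + 2·|I(v_1, v_2)|. -/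
/-- `C_0(G) = Σ_{c=1}^{d} C_{0c}(G)`: total number of bicolored cycles containing the color 0. -/
noncomputable def C0 {n d : ℕ} (σ : Fin (d + 1) → Equiv.Perm (Fin n)) : ℕ :=
  ∑ c ∈ Finset.univ.erase (0 : Fin (d + 1)), numCycles ((σ c)⁻¹ * σ 0)

open Equiv in
/-- A function invariant under one step of `π` is constant on cycles. -/
theorem inv_of_sameCycle {α β : Type*} [Finite α] (π : Perm α) (f : α → β)
    (h : ∀ x, f (π x) = f x) {x y : α} (hxy : π.SameCycle x y) : f x = f y := by
  obtain ⟨k, hk⟩ := hxy.exists_nat_pow_eq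
  have key : ∀ k : ℕ, f ((π ^ k) x) = f x := by
    intro k
    induction k with
    | zero => simp
    | succ k ih => rw [pow_succ', Perm.mul_apply, h, ih]
  rw [← hk, key]

open Equiv in
/-- Walking along `π` from `b` agrees with walking along `π * swap a b` from `a`. -/
theorem flip_walk {α : Type*} [DecidableEq α] (π : Perm α) (a b : α) (k : ℕ)
    (hk : ∀ j, 0 < j → j < k → (π ^ j) b ≠ a ∧ (π ^ j) b ≠ b) (j : ℕ) (hj : 0 < j)
    (hjk : j ≤ k) : ((π * swap a b) ^ j) a = (π ^ j) b := by
  induction j with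
  | zero => omega
  | succ j ih =>
    rcases Nat.eq_zero_or_pos j with rfl | hj0
    · simp
    · rw [pow_succ', Perm.mul_apply, ih hj0 (by omega), pow_succ' π, Perm.mul_apply,
        Perm.mul_apply]
      obtain ⟨h1, h2⟩ := hk j hj0 (by omega)
      rw [swap_apply_of_ne_of_ne h1 h2]

open Equiv in
theorem sameCycle_flip {α : Type*} [DecidableEq α] [Finite α] (π : Perm α) (a b : α)
    (h : ¬ π.SameCycle a b) : (π * swap a b).SameCycle a b := by
  have hex : ∃ k, 0 < k ∧ (π ^ k) b = b :=
    ⟨orderOf π, orderOf_pos π, by simp [pow_orderOf_eq_one]⟩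
  classical
  obtain ⟨h0, hb⟩ := Nat.find_spec hex
  refine ⟨(Nat.find hex : ℕ), ?_⟩
  rw [zpow_natCast, flip_walk π a b (Nat.find hex) _ _ h0 le_rfl, hb]
  intro j hj hjk
  refine ⟨fun e => h (Perm.SameCycle.symm ⟨j, by simpa using e⟩), fun e => ?_⟩
  exact Nat.find_min hex hjk ⟨hj, e⟩

open Equiv in
theorem not_sameCycle_flip {α : Type*} [DecidableEq α] [Finite α] (π : Perm α) (a b : α)
    (hab : a ≠ b) (h : π.SameCycle a b) : ¬ (π * swap a b).SameCycle a b := by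
  have hex : ∃ k, 0 < k ∧ (π ^ k) b = a := by
    obtain ⟨k, hk⟩ := h.symm.exists_nat_pow_eq
    refine ⟨k, Nat.pos_of_ne_zero ?_, hk⟩
    rintro rfl
    exact hab (by simpa using hk.symm)
  classical
  obtain ⟨h0, hb⟩ := Nat.find_spec hex
  set k := Nat.find hex with hkdef
  have hmin : ∀ j, 0 < j → j < k → (π ^ j) b ≠ a := fun j hj hjk e =>
    Nat.find_min hex hjk ⟨hj, e⟩
  have hminb : ∀ j, 0 < j → j ≤ k → (π ^ j) b ≠ b := by
    intro j hj hjk e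
    rcases hjk.eq_or_lt with rfl | hlt
    · exact hab (hb.symm.trans e)
    · apply hmin (k - j) (by omega) (by omega)
      rw [← hb]
      conv_rhs => rw [show k = (k - j) + j by omega, pow_add, Perm.mul_apply, e]
  have hw := flip_walk π a b k (fun j hj hjk => ⟨hmin j hj hjk, hminb j hj hjk.le⟩)
  intro hs
  obtain ⟨m, hm⟩ := hs.exists_nat_pow_eq
  have hper : ((π * swap a b) ^ k) a = a := by rw [hw k h0 le_rfl, hb]
  have hmod : ((π * swap a b) ^ (m % k)) a = b := by
    refine Eq.trans ?_ hm
    conv_rhs => rw [← Nat.mod_add_div m k, pow_add, Perm.mul_apply, pow_mul,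
      Perm.pow_apply_eq_self_of_apply_eq_self hper]
  rcases Nat.eq_zero_or_pos (m % k) with h1 | h1
  · rw [h1] at hmod
    exact hab (by simpa using hmod)
  · have hlt := (Nat.mod_lt m h0).le
    rw [hw _ h1 hlt] at hmod
    exact hminb _ h1 hlt hmod

open Equiv in
theorem numCycles_flip_of_not {α : Type*} [DecidableEq α] [Finite α] (π : Perm α) (a b : α)
    (h : ¬ π.SameCycle a b) : numCycles (π * swap a b) + 1 = numCycles π := by
  classical
  have hs := sameCycle_flip π a b h
  have hstep : ∀ x y, π.SameCycle x y → (π * swap a b).SameCycle x y := by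
    intro x y hxy
    have := inv_of_sameCycle π
      (fun x => (Quotient.mk (permSetoid (π * swap a b)) x)) (fun x => by
        apply Quotient.sound
        change (π * swap a b).SameCycle (π x) x
        have e : π x = (π * swap a b) (swap a b x) := by simp
        rw [e, Perm.sameCycle_apply_left]
        by_cases hxa : x = a
        · subst hxa; simpa using hs.symm
        by_cases hxb : x = b
        · subst hxb; simpa using hs
        rw [swap_apply_of_ne_of_ne hxa hxb]) hxy
    exact Quotient.exact this
  let g : α → Quotient (permSetoid π) := fun x =>
    if π.SameCycle x b then Quotient.mk _ a else Quotient.mk _ x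
  have hgS : ∀ x y, π.SameCycle x y → g x = g y := by
    intro x y hxy
    have : π.SameCycle x b ↔ π.SameCycle y b := ⟨hxy.symm.trans, hxy.trans⟩
    simp only [g, this]
    split_ifs
    · rfl
    · exact Quotient.sound hxy
  have hgab : g a = g b := by
    simp only [g, h, if_false, Perm.SameCycle.refl π b, if_true]
  have hg : ∀ x y, (π * swap a b).SameCycle x y → g x = g y := by
    intro x y hxy
    refine inv_of_sameCycle _ g (fun x => ?_) hxy
    rw [Perm.mul_apply, ← hgS (swap a b x) _ (Perm.sameCycle_apply_right.2 (.refl _ _))]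
    by_cases hxa : x = a
    · subst hxa; simpa using hgab.symm
    by_cases hxb : x = b
    · subst hxb; simpa using hgab
    rw [swap_apply_of_ne_of_ne hxa hxb]
  let qb : Quotient (permSetoid π) := Quotient.mk _ b
  let F : {q : Quotient (permSetoid π) // q ≠ qb} → Quotient (permSetoid (π * swap a b)) :=
    fun q => Quotient.map' (s₂ := permSetoid (π * swap a b)) id hstep q.1
  have hF : Function.Bijective F := by
    constructor
    · rintro ⟨q, hq⟩ ⟨r, hr⟩ e
      induction q using Quotient.inductionOn with | _ x => ?_
      induction r using Quotient.inductionOn with | _ y => ?_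
      have hx : ¬ π.SameCycle x b := fun hh => hq (Quotient.sound hh)
      have hy : ¬ π.SameCycle y b := fun hh => hr (Quotient.sound hh)
      have e' : (π * swap a b).SameCycle x y := Quotient.exact e
      have := hg x y e'
      simp only [g, hx, hy, if_false] at this
      exact Subtype.ext this
    · intro q
      induction q using Quotient.inductionOn with | _ x => ?_
      by_cases hx : π.SameCycle x b
      · exact ⟨⟨Quotient.mk _ a, fun hh => h (Quotient.exact hh)⟩,
          Quotient.sound (hs.trans (hstep _ _ hx).symm)⟩
      · exact ⟨⟨Quotient.mk _ x, fun hh => hx (Quotient.exact hh)⟩, rfl⟩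
  unfold numCycles
  rw [← Nat.card_eq_of_bijective F hF]
  have h1 := Nat.card_congr (Equiv.sumCompl (fun q : Quotient (permSetoid π) => q = qb))
  rw [Nat.card_sum, Nat.card_unique] at h1
  rw [← h1, add_comm]

open Equiv in
theorem numCycles_flip_of_same {α : Type*} [DecidableEq α] [Finite α] (π : Perm α) (a b : α)
    (hab : a ≠ b) (h : π.SameCycle a b) : numCycles (π * swap a b) = numCycles π + 1 := by
  have := numCycles_flip_of_not (π * swap a b) a b (not_sameCycle_flip π a b hab h)
  rw [mul_assoc, swap_mul_self, mul_one] at this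
  exact this.symm

/-- **Edge-flip lemma (general formula)**: if flipping the two color-0 edges at the distinct
white vertices `v₁, v₂` of a connected colored graph `G` yields a connected graph `G'`, then
`C₀(G') = C₀(G) − d + 2·|I(v₁,v₂)|`, where `I(v₁,v₂)` is the set of colors `c ≠ 0` for which
`v₁` and `v₂` lie on the same bicolored cycle of colors `{0,c}`. -/
theorem flip_formula {d n : ℕ} (σ : Fin (d + 1) → Equiv.Perm (Fin n))
    (hconn : ColoredConnected σ) (v₁ v₂ : Fin n) (hne : v₁ ≠ v₂)
    (hconn' : ColoredConnected (Function.update σ 0 (σ 0 * Equiv.swap v₁ v₂))) :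
    C0 (Function.update σ 0 (σ 0 * Equiv.swap v₁ v₂)) + d =
      C0 σ + 2 * Nat.card {c : Fin (d + 1) // c ≠ 0 ∧ ((σ c)⁻¹ * σ 0).SameCycle v₁ v₂} := by
  classical
  have hcard : Nat.card {c : Fin (d + 1) // c ≠ 0 ∧ ((σ c)⁻¹ * σ 0).SameCycle v₁ v₂} =
      ∑ c ∈ Finset.univ.erase (0 : Fin (d + 1)),
        if ((σ c)⁻¹ * σ 0).SameCycle v₁ v₂ then 1 else 0 := by
    rw [Nat.card_eq_fintype_card, Fintype.card_subtype, ← Finset.card_filter]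
    congr 1
    ext c
    simp
  have hd : d = ∑ c ∈ Finset.univ.erase (0 : Fin (d + 1)), 1 := by simp
  rw [hcard]
  refine (congrArg (C0 (Function.update σ 0 (σ 0 * Equiv.swap v₁ v₂)) + ·) hd).trans ?_
  unfold C0
  simp only [Finset.mul_sum, ← Finset.sum_add_distrib]
  refine Finset.sum_congr rfl fun c hc => ?_
  rw [Function.update_self, Function.update_of_ne (Finset.ne_of_mem_erase hc), ← mul_assoc]
  split_ifs with h
  · rw [numCycles_flip_of_same _ _ _ hne h]; omega
  · rw [numCycles_flip_of_not _ _ _ h]; omega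
end

section
/- Bicolored cycles through a 2-edge-cut: Let G = (σ_0, σ_1, …, σ_d) be a connected colored graph on 2n vertices. Suppose S is a nonempty proper subset of the white vertices Fin n such that σ_c(S) = T for every color c ∈ {1,…,d}, where T := σ_1(S), and suppose there is exactly one white vertex v_1 ∈ S with σ_0 v_1 ∉ T and exactly one white vertex v_2 ∉ S with σ_0 v_2 ∈ T (so the two color-0 edges at v_1 and v_2 form a 2-edge-cut separating the two sides). Then for every color c ∈ {1,…,d}, the white vertices v_1 and v_2 lie in the same orbit of σ_c⁻¹ * σ_0; consequently C_0 of the flipped tuple (σ_0 ∘ swap(v_1, v_2), σ_1, …, σ_d) equals C_0(G) + d. -/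
theorem sameCycle_rel {α : Type*} (f : Equiv.Perm α) (R : α → α → Prop) (hR : Equivalence R)
    (h : ∀ x, R x (f x)) {x y : α} (hxy : f.SameCycle x y) : R x y := by
  obtain ⟨k, rfl⟩ := hxy
  induction k using Int.induction_on with
  | zero => simpa using hR.refl x
  | succ k ih =>
    have := h ((f ^ (k : ℤ)) x)
    rw [← Equiv.Perm.mul_apply, ← zpow_one_add, add_comm] at this
    exact hR.trans ih this
  | pred k ih =>
    have := h ((f ^ (-(k : ℤ) - 1)) x)
    rw [← Equiv.Perm.mul_apply, ← zpow_one_add, add_sub_cancel] at this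
    exact hR.trans ih (hR.symm this)

theorem numCycles_mul_swap {α : Type*} [Finite α] [DecidableEq α] (f : Equiv.Perm α) (a b : α)
    (hab : f.SameCycle a b) (hab' : ¬ (f * Equiv.swap a b).SameCycle a b) :
    numCycles (f * Equiv.swap a b) = numCycles f + 1 := by
  classical
  set g := f * Equiv.swap a b with hg
  have hgf : ∀ x y, g.SameCycle x y → f.SameCycle x y := by
    intro x y hxy
    refine sameCycle_rel g f.SameCycle (permSetoid f).iseqv (fun x => ?_) hxy
    rw [hg, Equiv.Perm.mul_apply, Equiv.Perm.sameCycle_apply_right, Equiv.swap_apply_def]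
    split_ifs with h1 h2
    · exact h1 ▸ hab
    · exact h2 ▸ hab.symm
    · exact Equiv.Perm.SameCycle.refl _ _
  have hfg : ∀ x y, f.SameCycle x y → g.SameCycle x y ∨
      ((g.SameCycle x a ∨ g.SameCycle x b) ∧ (g.SameCycle y a ∨ g.SameCycle y b)) := by
    intro x y hxy
    refine sameCycle_rel f (fun x y => g.SameCycle x y ∨
      ((g.SameCycle x a ∨ g.SameCycle x b) ∧ (g.SameCycle y a ∨ g.SameCycle y b)))
      ⟨fun x => Or.inl (Equiv.Perm.SameCycle.refl _ _), ?_, ?_⟩ (fun x => ?_) hxy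
    · rintro x y (h | ⟨h1, h2⟩)
      · exact Or.inl h.symm
      · exact Or.inr ⟨h2, h1⟩
    · rintro x y z (h | ⟨h1, h2⟩) (h' | ⟨h1', h2'⟩)
      · exact Or.inl (h.trans h')
      · exact Or.inr ⟨h1'.imp h.trans h.trans, h2'⟩
      · exact Or.inr ⟨h1, h2.imp h'.symm.trans h'.symm.trans⟩
      · exact Or.inr ⟨h1, h2'⟩
    · have hx : f x = g (Equiv.swap a b x) := by simp [hg]
      simp only [hx, Equiv.Perm.sameCycle_apply_right, Equiv.Perm.sameCycle_apply_left]
      rw [Equiv.swap_apply_def]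
      split_ifs with h1 h2
      · subst h1
        exact Or.inr ⟨Or.inl (Equiv.Perm.SameCycle.refl _ _), Or.inr (Equiv.Perm.SameCycle.refl _ _)⟩
      · subst h2
        exact Or.inr ⟨Or.inr (Equiv.Perm.SameCycle.refl _ _), Or.inl (Equiv.Perm.SameCycle.refl _ _)⟩
      · exact Or.inl (Equiv.Perm.SameCycle.refl _ _)
  let B : Quotient (permSetoid g) := Quotient.mk _ b
  let F : {q : Quotient (permSetoid g) // q ≠ B} → Quotient (permSetoid f) :=
    fun q => Quotient.map' (s₁ := permSetoid g) (s₂ := permSetoid f) id hgf q.1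
  have hF : Function.Bijective F := by
    constructor
    · rintro ⟨p, hp⟩ ⟨q, hq⟩ h
      induction p using Quotient.inductionOn with | _ x =>
      induction q using Quotient.inductionOn with | _ y =>
      have h' : f.SameCycle x y := Quotient.exact (s := permSetoid f) h
      have hxb : ¬ g.SameCycle x b := fun h => hp (Quotient.sound (s := permSetoid g) h)
      have hyb : ¬ g.SameCycle y b := fun h => hq (Quotient.sound (s := permSetoid g) h)
      apply Subtype.ext
      apply Quotient.sound (s := permSetoid g)
      rcases hfg x y h' with h | ⟨h1, h2⟩
      · exact h
      · exact (h1.resolve_right hxb).trans (h2.resolve_right hyb).symm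
    · intro q
      induction q using Quotient.inductionOn with | _ x =>
      by_cases hx : g.SameCycle x b
      · refine ⟨⟨Quotient.mk (permSetoid g) a, fun h => hab' (Quotient.exact h)⟩, ?_⟩
        exact Quotient.sound (s := permSetoid f) (hab.trans (hgf _ _ hx).symm)
      · exact ⟨⟨Quotient.mk (permSetoid g) x, fun h => hx (Quotient.exact h)⟩, rfl⟩
  unfold numCycles
  rw [← Nat.card_congr (Equiv.ofBijective F hF), ← Finite.card_option]
  exact Nat.card_congr (Equiv.optionSubtypeNe B).symm

theorem cut_sameCycle {α : Type*} [Finite α] (f : Equiv.Perm α) (S : Set α) (a b : α)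
    (ha : a ∈ S) (hfa : f a ∉ S) (h : ∀ x, x ∉ S → x ≠ b → f x ∉ S) : f.SameCycle a b := by
  by_contra hn
  have key : ∀ k : ℕ, (f ^ (k + 1)) a ∉ S := by
    intro k
    induction k with
    | zero => simpa using hfa
    | succ k ih =>
      rw [pow_succ', Equiv.Perm.mul_apply]
      exact h _ ih fun hb => hn ⟨(k + 1 : ℕ), by rw [zpow_natCast]; exact hb⟩
  have := key (orderOf f - 1)
  rw [Nat.sub_add_cancel (orderOf_pos f), pow_orderOf_eq_one] at this
  exact this ha

theorem cut_not_sameCycle {α : Type*} [DecidableEq α] (f : Equiv.Perm α) (S : Set α) (a b : α)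
    (ha : a ∈ S) (hb : b ∉ S) (hfa : f a ∉ S) (hfb : f b ∈ S)
    (h : ∀ x, x ∉ S → x ≠ b → f x ∉ S) (h' : ∀ x, x ∈ S → x ≠ a → f x ∈ S) :
    ¬ (f * Equiv.swap a b).SameCycle a b := by
  intro hs
  refine hb ((sameCycle_rel _ (fun x y => x ∈ S ↔ y ∈ S)
    ⟨fun _ => Iff.rfl, fun h => h.symm, fun h h' => h.trans h'⟩ (fun x => ?_) hs).1 ha)
  rw [Equiv.Perm.mul_apply, Equiv.swap_apply_def]
  split_ifs with h1 h2
  · subst h1; exact iff_of_true ha hfb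
  · subst h2; exact iff_of_false hb hfa
  · by_cases hx : x ∈ S
    · exact iff_of_true hx (h' x hx h1)
    · exact iff_of_false hx (h x hx h2)

/-- **Bicolored cycles through a 2-edge-cut**: suppose `S` is a nonempty proper set of white
vertices with `σ_c(S) = T := σ_1(S)` for every color `c ≠ 0`, and there is exactly one white
vertex `v₁ ∈ S` with `σ_0 v₁ ∉ T` and exactly one white vertex `v₂ ∉ S` with `σ_0 v₂ ∈ T`
(the two color-0 edges at `v₁` and `v₂` form a 2-edge-cut). Then for every color `c ≠ 0` the
vertices `v₁, v₂` lie on the same bicolored cycle of colors `{0,c}`, and consequently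
`C₀` of the flipped tuple equals `C₀(G) + d`. -/
theorem two_edge_cut_cycles {d n : ℕ} (hd : 1 ≤ d)
    (σ : Fin (d + 1) → Equiv.Perm (Fin n)) (hconn : ColoredConnected σ)
    (S : Set (Fin n)) (hS : S.Nonempty) (hSne : S ≠ Set.univ)
    (T : Set (Fin n)) (hT1 : T = ⇑(σ 1) '' S)
    (hTc : ∀ c : Fin (d + 1), c ≠ 0 → ⇑(σ c) '' S = T)
    (v₁ v₂ : Fin n)
    (hv₁S : v₁ ∈ S) (hv₁T : σ 0 v₁ ∉ T)
    (hv₁uniq : ∀ w ∈ S, σ 0 w ∉ T → w = v₁)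
    (hv₂S : v₂ ∉ S) (hv₂T : σ 0 v₂ ∈ T)
    (hv₂uniq : ∀ w, w ∉ S → σ 0 w ∈ T → w = v₂) :
    (∀ c : Fin (d + 1), c ≠ 0 → ((σ c)⁻¹ * σ 0).SameCycle v₁ v₂) ∧
      C0 (Function.update σ 0 (σ 0 * Equiv.swap v₁ v₂)) = C0 σ + d := by
  have hmem : ∀ c : Fin (d + 1), c ≠ 0 → ∀ x, ((σ c)⁻¹ * σ 0) x ∈ S ↔ σ 0 x ∈ T := by
    intro c hc x
    rw [← hTc c hc, Equiv.Perm.mul_apply]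
    constructor
    · intro h
      exact ⟨_, h, by simp⟩
    · rintro ⟨y, hy, hxy⟩
      rw [← hxy]
      simpa using hy
  have h1 : ∀ c : Fin (d + 1), c ≠ 0 → ∀ x, x ∉ S → x ≠ v₂ → ((σ c)⁻¹ * σ 0) x ∉ S :=
    fun c hc x hx hne h => hne (hv₂uniq x hx ((hmem c hc x).1 h))
  have h2 : ∀ c : Fin (d + 1), c ≠ 0 → ∀ x, x ∈ S → x ≠ v₁ → ((σ c)⁻¹ * σ 0) x ∈ S :=
    fun c hc x hx hne => (hmem c hc x).2 (by
      by_contra h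
      exact hne (hv₁uniq x hx h))
  have hsame : ∀ c : Fin (d + 1), c ≠ 0 → ((σ c)⁻¹ * σ 0).SameCycle v₁ v₂ := fun c hc =>
    cut_sameCycle _ S v₁ v₂ hv₁S (fun h => hv₁T ((hmem c hc _).1 h)) (h1 c hc)
  refine ⟨hsame, ?_⟩
  have hsum : ∀ c ∈ Finset.univ.erase (0 : Fin (d + 1)),
      numCycles ((Function.update σ 0 (σ 0 * Equiv.swap v₁ v₂) c)⁻¹ *
        Function.update σ 0 (σ 0 * Equiv.swap v₁ v₂) 0) = numCycles ((σ c)⁻¹ * σ 0) + 1 := by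
    intro c hc
    have hc := Finset.ne_of_mem_erase hc
    rw [Function.update_of_ne hc, Function.update_self, ← mul_assoc]
    exact numCycles_mul_swap _ _ _ (hsame c hc)
      (cut_not_sameCycle _ S v₁ v₂ hv₁S hv₂S (fun h => hv₁T ((hmem c hc _).1 h))
        ((hmem c hc _).2 hv₂T) (h1 c hc) (h2 c hc))
  unfold C0
  rw [Finset.sum_congr rfl hsum, Finset.sum_add_distrib]
  simp
end

section
/- Lemma on highly parallel edges in one-bubble graphs: Let d ≥ 1 and let B = (σ_1, …, σ_d) be a connected bubble on 2n vertices. Suppose there are a white vertex v and a black vertex v̄ such that 2·|{c ∈ {1,…,d} : σ_c v = v̄}| > d (v and v̄ are connected by q > d/2 parallel edges). Then every pairing σ_0 of B that maximizes C_0(σ_0) over all pairings satisfies σ_0 v = v̄. -/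
/-- Connectivity of the bubble `(σ 1, …, σ d)` (colors indexed by `Fin d`). -/
def BubbleConnected {n d : ℕ} (σ : Fin d → Equiv.Perm (Fin n)) : Prop :=
  ∀ x y : Fin n,
    ∃ g ∈ Subgroup.closure {g : Equiv.Perm (Fin n) | ∃ a b : Fin d, g = (σ a)⁻¹ * σ b},
      g x = y

/-- `C_0(σ₀)` for a pairing `σ₀` of the bubble `(σ 1, …, σ d)`:
the total number of bicolored cycles with colors `{0,c}`. -/
noncomputable def pairingCycles {n d : ℕ} (σ : Fin d → Equiv.Perm (Fin n))
    (σ₀ : Equiv.Perm (Fin n)) : ℕ :=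
  ∑ c : Fin d, numCycles ((σ c)⁻¹ * σ₀)

theorem invariant_sameCycle {α β : Type*} (π : Equiv.Perm α) (f : α → β)
    (hf : ∀ x, f (π x) = f x) {x y : α} (h : π.SameCycle x y) : f x = f y := by
  obtain ⟨k, rfl⟩ := h
  have hi : ∀ x, f (π⁻¹ x) = f x := fun x => by
    rw [← hf (π⁻¹ x)]; simp
  induction k using Int.induction_on with
  | zero => simp
  | succ i ih => rw [add_comm, zpow_add, zpow_one, Equiv.Perm.mul_apply, hf]; exact ih
  | pred i ih =>
    rw [sub_eq_add_neg, add_comm, zpow_add, zpow_neg_one, Equiv.Perm.mul_apply, hi]; exact ih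

theorem mk_apply_eq {α : Type*} (π : Equiv.Perm α) (x : α) :
    (Quotient.mk (permSetoid π) (π x)) = Quotient.mk (permSetoid π) x :=
  Quotient.sound (s := permSetoid π) (show π.SameCycle (π x) x from ⟨-1, by simp⟩)

theorem numCycles_le_swap {α : Type*} [Finite α] [DecidableEq α] (π : Equiv.Perm α) (v w : α) :
    numCycles π ≤ numCycles (π * Equiv.swap v w) + 1 := by
  classical
  let m : α → Quotient (permSetoid π) := Quotient.mk (permSetoid π)
  have hm : ∀ x, m (π x) = m x := mk_apply_eq π
  let f : α → Quotient (permSetoid π) := fun x => if m x = m v then m w else m x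
  have hf : ∀ x, f ((π * Equiv.swap v w) x) = f x := by
    intro x
    simp only [f, Equiv.Perm.mul_apply, hm]
    by_cases h1 : x = v
    · subst h1; simp
    by_cases h2 : x = w
    · subst h2; simp
    rw [Equiv.swap_apply_of_ne_of_ne h1 h2]
  let F : Option (Quotient (permSetoid (π * Equiv.swap v w))) → Quotient (permSetoid π) :=
    fun o => o.elim (m v) (Quotient.lift f (fun _ _ h => invariant_sameCycle _ f hf h))
  have hF : Function.Surjective F := by
    intro q
    induction q using Quotient.inductionOn with | _ x => ?_
    by_cases h : m x = m v
    · exact ⟨none, h.symm⟩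
    · exact ⟨some (Quotient.mk _ x), if_neg h⟩
  have := Nat.card_le_card_of_surjective F hF
  rwa [Finite.card_option] at this

theorem numCycles_swap_split {α : Type*} [Finite α] [DecidableEq α] (π : Equiv.Perm α) (v w : α)
    (hw : π w = v) (hne : w ≠ v) :
    numCycles π + 1 ≤ numCycles (π * Equiv.swap v w) := by
  classical
  let m : α → Quotient (permSetoid π) := Quotient.mk (permSetoid π)
  have hm : ∀ x, m (π x) = m x := mk_apply_eq π
  let f : α → Option (Quotient (permSetoid π)) := fun x => if x = v then none else some (m x)
  have hmw : m v = m w := by rw [← hm w, hw]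
  have hf : ∀ x, f ((π * Equiv.swap v w) x) = f x := by
    intro x
    simp only [f, Equiv.Perm.mul_apply, hm]
    by_cases h1 : x = v
    · rw [h1, Equiv.swap_apply_left, hw]; simp
    by_cases h2 : x = w
    · have : π v ≠ v := fun h => hne (π.injective (hw.trans h.symm))
      rw [h2, Equiv.swap_apply_right, if_neg this, if_neg hne, hmw]
    rw [Equiv.swap_apply_of_ne_of_ne h1 h2]
    have : π x ≠ v := fun h => h2 (π.injective (h.trans hw.symm))
    rw [if_neg this, if_neg h1]
  let F : Quotient (permSetoid (π * Equiv.swap v w)) → Option (Quotient (permSetoid π)) :=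
    Quotient.lift f (fun _ _ h => invariant_sameCycle _ f hf h)
  have hF : Function.Surjective F := by
    intro q
    rcases q with _ | q
    · exact ⟨Quotient.mk _ v, if_pos rfl⟩
    induction q using Quotient.inductionOn with | _ x => ?_
    by_cases h : x = v
    · exact ⟨Quotient.mk _ w, (if_neg hne).trans (by rw [h]; exact congrArg some hmw.symm)⟩
    · exact ⟨Quotient.mk _ x, if_neg h⟩
  have := Nat.card_le_card_of_surjective F hF
  rwa [Finite.card_option] at this

/-- **Lemma on highly parallel edges in one-bubble graphs**: if a white vertex `v` and a black
vertex `vb` of a connected bubble are connected by `q > d/2` parallel edges, then every pairing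
`σ₀` maximizing `C_0` over all pairings satisfies `σ₀ v = vb`. -/
theorem parallel_edges_force_pairing {d n : ℕ} (hd : 1 ≤ d)
    (σ : Fin d → Equiv.Perm (Fin n)) (hconn : BubbleConnected σ)
    (v vb : Fin n) (hq : d < 2 * Nat.card {c : Fin d // σ c v = vb})
    (σ₀ : Equiv.Perm (Fin n))
    (hmax : ∀ τ : Equiv.Perm (Fin n), pairingCycles σ τ ≤ pairingCycles σ σ₀) :
    σ₀ v = vb := by
  classical
  by_contra hne
  obtain ⟨w, hw⟩ := σ₀.surjective vb
  have hwv : w ≠ v := by rintro rfl; exact hne hw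
  have hlt := hmax (σ₀ * Equiv.swap v w)
  unfold pairingCycles at hlt
  have key : ∀ c : Fin d, numCycles ((σ c)⁻¹ * σ₀) + 2 * (if σ c v = vb then 1 else 0) ≤
      numCycles ((σ c)⁻¹ * (σ₀ * Equiv.swap v w)) + 1 := by
    intro c
    rw [← mul_assoc]
    split_ifs with h
    · have := numCycles_swap_split ((σ c)⁻¹ * σ₀) v w (by simp [hw, ← h]) hwv
      omega
    · exact numCycles_le_swap _ v w
  have hs := Finset.sum_le_sum (fun c (_ : c ∈ Finset.univ) => key c)
  rw [Finset.sum_add_distrib, Finset.sum_add_distrib, ← Finset.mul_sum, Finset.sum_boole] at hs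
  rw [Nat.card_eq_fintype_card, Fintype.card_subtype] at hq
  simp at hs
  omega
end

section
/- No 4-edge-cuts of color 0 in maximizers (odd dimension): Let d be odd and let G = (σ_0, σ_1, …, σ_d) be a connected colored graph on 2n vertices that maximizes C_0 among all connected colored graphs (τ_0, σ_1, …, σ_d) with the same bubbles (τ_0 ranging over all permutations of Fin n making the graph connected). Then G has no 4-edge-cut consisting of four edges of color 0. -/
/-- An edge of the colored graph `G = (σ 0, …, σ d)` is encoded as a pair `(i, c)`:
the edge of color `c` joining white `i` to black `σ c i`.  `G` minus a set `E` of edges is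
connected if the equivalence relation on whites ⊕ blacks generated by relating white `i` to
black `σ c i` for every edge `(i, c) ∉ E` has a single class. -/
def minusConnected {n d : ℕ} (σ : Fin (d + 1) → Equiv.Perm (Fin n))
    (E : Set (Fin n × Fin (d + 1))) : Prop :=
  ∀ x y : Fin n ⊕ Fin n,
    Relation.EqvGen
      (fun p q => ∃ (i : Fin n) (c : Fin (d + 1)),
        (i, c) ∉ E ∧ p = Sum.inl i ∧ q = Sum.inr (σ c i)) x y

/-- A set `E` of edges of a connected colored graph is an edge-cut if removing it disconnects
the graph while removing any proper subset does not. -/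
def IsEdgeCut {n d : ℕ} (σ : Fin (d + 1) → Equiv.Perm (Fin n))
    (E : Set (Fin n × Fin (d + 1))) : Prop :=
  ¬ minusConnected σ E ∧
    ∀ E' : Set (Fin n × Fin (d + 1)), E' ⊂ E → minusConnected σ E'

open Equiv.Perm in
theorem sameCycle_closed {α : Type*} [Finite α] (π : Equiv.Perm α) (S : Set α)
    (hS : ∀ z ∈ S, π z ∈ S) {z w : α} (h : π.SameCycle z w) (hz : z ∈ S) : w ∈ S := by
  obtain ⟨i, -, -, hi⟩ := h.exists_pow_eq''
  have : ∀ k : ℕ, (π ^ k) z ∈ S := by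
    intro k
    induction k with
    | zero => simpa using hz
    | succ k ih => rw [pow_succ', Equiv.Perm.mul_apply]; exact hS _ ih
  exact hi ▸ this i

theorem iterate_swap_eq {α : Type*} [DecidableEq α] (π : Equiv.Perm α) (x y : α) (k : ℕ)
    (hk : ∀ j, 1 ≤ j → j ≤ k → (π ^ j) y ≠ x ∧ (π ^ j) y ≠ y) :
    ((π * Equiv.swap x y) ^ (k + 1)) x = (π ^ (k + 1)) y := by
  induction k with
  | zero => simp
  | succ k ih =>
    have h1 := ih (fun j h1 h2 => hk j h1 (by omega))
    rw [pow_succ', Equiv.Perm.mul_apply, h1, pow_succ' π (k + 1), Equiv.Perm.mul_apply,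
      Equiv.Perm.mul_apply]
    have := hk (k + 1) (by omega) le_rfl
    rw [Equiv.swap_apply_of_ne_of_ne this.1 this.2]

/-- First return of `y` to `{x, y}`. -/
theorem first_return {α : Type*} [Finite α] (π : Equiv.Perm α) (x y : α) :
    ∃ k : ℕ, (∀ j, 1 ≤ j → j ≤ k → (π ^ j) y ≠ x ∧ (π ^ j) y ≠ y) ∧
      ((π ^ (k + 1)) y = x ∨ (π ^ (k + 1)) y = y) := by
  classical
  have hex : ∃ k : ℕ, ((π ^ (k + 1)) y = x ∨ (π ^ (k + 1)) y = y) := by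
    have h := (Equiv.Perm.SameCycle.refl π y).exists_pow_eq''
    obtain ⟨i, hi, -, h⟩ := h
    refine ⟨i - 1, Or.inr ?_⟩
    rwa [Nat.sub_add_cancel hi]
  refine ⟨Nat.find hex, ?_, Nat.find_spec hex⟩
  intro j h1 h2
  have := Nat.find_min hex (m := j - 1) (by omega)
  rw [Nat.sub_add_cancel h1] at this
  tauto

theorem merge_sameCycle {α : Type*} [Finite α] [DecidableEq α] (π : Equiv.Perm α) (x y : α)
    (h : ¬ π.SameCycle x y) : (π * Equiv.swap x y).SameCycle x y := by
  obtain ⟨k, hk, hr⟩ := first_return π x y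
  have h1 := iterate_swap_eq π x y k hk
  rcases hr with hr | hr
  · exact absurd (Equiv.Perm.SameCycle.symm ⟨(k + 1 : ℕ), by rw [zpow_natCast]; exact hr⟩) h
  · exact ⟨(k + 1 : ℕ), by rw [zpow_natCast, h1, hr]⟩

theorem split_sameCycle {α : Type*} [Finite α] [DecidableEq α] (π : Equiv.Perm α) (x y : α)
    (hxy : x ≠ y) (h : π.SameCycle x y) : ¬ (π * Equiv.swap x y).SameCycle x y := by
  obtain ⟨k, hk, hr⟩ := first_return π x y
  have hr' : (π ^ (k + 1)) y = x := by
    rcases hr with hr | hr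
    · exact hr
    · exfalso
      have := sameCycle_closed π {z | ∃ j, 1 ≤ j ∧ j ≤ k + 1 ∧ (π ^ j) y = z} ?_ h.symm
        ⟨k + 1, by omega, le_rfl, hr⟩
      · obtain ⟨j, h1, h2, h3⟩ := this
        by_cases hj : j ≤ k
        · exact (hk j h1 hj).1 h3
        · have : j = k + 1 := by omega
          subst this
          exact hxy (h3.symm.trans hr)
      · rintro z ⟨j, h1, h2, rfl⟩
        by_cases hj : j ≤ k
        · exact ⟨j + 1, by omega, by omega, by rw [pow_succ', Equiv.Perm.mul_apply]⟩
        · have : j = k + 1 := by omega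
          subst this
          exact ⟨1, le_rfl, by omega, by rw [hr, pow_one]⟩
  intro hs
  have := sameCycle_closed (π * Equiv.swap x y) {z | ∃ j, 1 ≤ j ∧ j ≤ k + 1 ∧ (π ^ j) y = z}
    ?_ hs ⟨k + 1, by omega, le_rfl, hr'⟩
  · obtain ⟨j, h1, h2, h3⟩ := this
    by_cases hj : j ≤ k
    · exact (hk j h1 hj).2 h3
    · have : j = k + 1 := by omega
      subst this
      exact hxy (hr'.symm.trans h3)
  · rintro z ⟨j, h1, h2, rfl⟩
    by_cases hj : j ≤ k
    · refine ⟨j + 1, by omega, by omega, ?_⟩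
      rw [pow_succ', Equiv.Perm.mul_apply, Equiv.Perm.mul_apply,
        Equiv.swap_apply_of_ne_of_ne (hk j h1 hj).1 (hk j h1 hj).2]
    · have : j = k + 1 := by omega
      subst this
      exact ⟨1, le_rfl, by omega, by rw [hr', pow_one, Equiv.Perm.mul_apply, Equiv.swap_apply_left]⟩

theorem numCycles_split {α : Type*} [Finite α] [DecidableEq α] (π : Equiv.Perm α) (x y : α)
    (hxy : x ≠ y) (h : π.SameCycle x y) :
    numCycles (π * Equiv.swap x y) = numCycles π + 1 := by
  classical
  have hns := split_sameCycle π x y hxy h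
  set ρ := π * Equiv.swap x y with hρ
  have hle : ∀ z w, ρ.SameCycle z w → π.SameCycle z w := by
    intro z w hzw
    refine sameCycle_closed ρ {w | π.SameCycle z w} ?_ hzw (Equiv.Perm.SameCycle.refl π z)
    intro t ht
    have ht : π.SameCycle z t := ht
    change π.SameCycle z (π (Equiv.swap x y t))
    rw [Equiv.Perm.sameCycle_apply_right]
    by_cases h1 : t = x
    · subst h1; rw [Equiv.swap_apply_left]; exact ht.trans h
    by_cases h2 : t = y
    · subst h2; rw [Equiv.swap_apply_right]; exact ht.trans h.symm
    rwa [Equiv.swap_apply_of_ne_of_ne h1 h2]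
  have hS : ∀ z w, π.SameCycle z w → ¬ ρ.SameCycle z x → ¬ ρ.SameCycle z y →
      ρ.SameCycle z w := by
    intro z w hzw hx hy
    refine sameCycle_closed π {w | ρ.SameCycle z w} ?_ hzw (Equiv.Perm.SameCycle.refl ρ z)
    intro t ht
    have ht : ρ.SameCycle z t := ht
    have h1 : t ≠ x := fun e => hx (e ▸ ht)
    have h2 : t ≠ y := fun e => hy (e ▸ ht)
    have : π t = ρ t := by
      rw [hρ, Equiv.Perm.mul_apply, Equiv.swap_apply_of_ne_of_ne h1 h2]
    change ρ.SameCycle z (π t)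
    rw [this, Equiv.Perm.sameCycle_apply_right]
    exact ht
  let f : Quotient (permSetoid ρ) → Quotient (permSetoid π) := Quotient.map id hle
  let q : Quotient (permSetoid ρ) := Quotient.mk _ y
  have hbij : Function.Bijective (fun p : {p // p ≠ q} => f p.1) := by
    constructor
    · rintro ⟨a, ha⟩ ⟨b, hb⟩ hab
      apply Subtype.ext
      induction a using Quotient.inductionOn with | _ a => ?_
      induction b using Quotient.inductionOn with | _ b => ?_
      have hab' : π.SameCycle a b := Quotient.exact hab
      have ha' : ¬ ρ.SameCycle a y := fun e => ha (Quotient.sound e)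
      have hb' : ¬ ρ.SameCycle b y := fun e => hb (Quotient.sound e)
      apply Quotient.sound
      change ρ.SameCycle a b
      by_cases h1 : ρ.SameCycle a x
      · by_cases h2 : ρ.SameCycle b x
        · exact h1.trans h2.symm
        · exact (hS b a hab'.symm h2 hb').symm
      · exact hS a b hab' h1 ha'
    · intro p
      induction p using Quotient.inductionOn with | _ a => ?_
      by_cases ha : ρ.SameCycle a y
      · refine ⟨⟨Quotient.mk _ x, fun e => hns (Quotient.exact e)⟩, ?_⟩
        apply Quotient.sound
        exact h.trans (hle _ _ ha).symm
      · exact ⟨⟨Quotient.mk _ a, fun e => ha (Quotient.exact e)⟩, rfl⟩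
  have hc := Nat.card_eq_of_bijective _ hbij
  have : Nat.card (Option {p // p ≠ q}) = Nat.card (Quotient (permSetoid ρ)) :=
    Nat.card_congr (Equiv.optionSubtypeNe q)
  rw [Finite.card_option, hc] at this
  exact this.symm

theorem numCycles_merge {α : Type*} [Finite α] [DecidableEq α] (π : Equiv.Perm α) (x y : α)
    (h : ¬ π.SameCycle x y) :
    numCycles (π * Equiv.swap x y) + 1 = numCycles π := by
  have hxy : x ≠ y := fun e => h (e ▸ Equiv.Perm.SameCycle.refl π x)
  have := numCycles_split _ x y hxy (merge_sameCycle π x y h)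
  rw [mul_assoc, Equiv.swap_mul_self, mul_one] at this
  exact this.symm

open Classical in
/-- `1` if `x, y` lie on the same cycle, `-1` otherwise. -/
noncomputable def cyc {α : Type*} (π : Equiv.Perm α) (x y : α) : ℤ :=
  if π.SameCycle x y then 1 else -1

theorem numCycles_swap {α : Type*} [Finite α] [DecidableEq α] (π : Equiv.Perm α) (x y : α)
    (hxy : x ≠ y) : (numCycles (π * Equiv.swap x y) : ℤ) = numCycles π + cyc π x y := by
  unfold cyc
  split_ifs with h
  · rw [numCycles_split π x y hxy h]; push_cast; ring
  · rw [← numCycles_merge π x y h]; push_cast; ring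

theorem cyc_cases {α : Type*} (π : Equiv.Perm α) (x y : α) : cyc π x y = 1 ∨ cyc π x y = -1 := by
  unfold cyc; split_ifs <;> simp

theorem sameCycle_mul_swap {α : Type*} [Finite α] [DecidableEq α] (π : Equiv.Perm α)
    (p q x y : α) (hp : ¬ π.SameCycle x p) (hq : ¬ π.SameCycle x q) :
    (π * Equiv.swap p q).SameCycle x y ↔ π.SameCycle x y := by
  have key : ∀ t, π.SameCycle x t → (π * Equiv.swap p q) t = π t := by
    intro t ht
    have h1 : t ≠ p := fun e => hp (e ▸ ht)
    have h2 : t ≠ q := fun e => hq (e ▸ ht)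
    rw [Equiv.Perm.mul_apply, Equiv.swap_apply_of_ne_of_ne h1 h2]
  constructor
  · intro h
    refine sameCycle_closed _ {w | π.SameCycle x w} ?_ h (Equiv.Perm.SameCycle.refl π x)
    intro t ht
    have ht : π.SameCycle x t := ht
    change π.SameCycle x _
    rw [key t ht, Equiv.Perm.sameCycle_apply_right]
    exact ht
  · intro h
    refine (sameCycle_closed π {w | π.SameCycle x w ∧ (π * Equiv.swap p q).SameCycle x w} ?_ h
      ⟨Equiv.Perm.SameCycle.refl π x, Equiv.Perm.SameCycle.refl _ x⟩).2
    rintro t ⟨ht, ht'⟩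
    refine ⟨?_, ?_⟩
    · rw [Equiv.Perm.sameCycle_apply_right]; exact ht
    · rw [← key t ht, Equiv.Perm.sameCycle_apply_right]; exact ht'

section local_lemmas
variable {α : Type*} [Finite α] [DecidableEq α]

theorem not_same (ρ : Equiv.Perm α) (W : Set α)
    (hW : ∀ z, ρ z ∈ W ↔ z ∈ W) {a b : α} (ha : a ∈ W) (hb : b ∉ W) : ¬ ρ.SameCycle a b :=
  fun h => hb (sameCycle_closed ρ W (fun z hz => (hW z).2 hz) h ha)

theorem orig_le (ρ : Equiv.Perm α) (W : Set α)
    (hW : ∀ z, ρ z ∈ W ↔ z ∈ W) {a₁ a₂ b₁ b₂ : α} (ha₁ : a₁ ∈ W) (ha₂ : a₂ ∈ W)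
    (hb₁ : b₁ ∉ W) (hb₂ : b₂ ∉ W) :
    2 * (numCycles (ρ * Equiv.swap a₂ b₂ * Equiv.swap a₁ b₁) : ℤ) ≤
      2 * numCycles ρ + cyc ρ a₁ a₂ + cyc ρ b₁ b₂ - 2 := by
  have h1 : a₁ ≠ b₁ := fun e => hb₁ (e ▸ ha₁)
  have h2 : a₂ ≠ b₂ := fun e => hb₂ (e ▸ ha₂)
  rw [numCycles_swap _ _ _ h1, numCycles_swap _ _ _ h2]
  have hn : cyc ρ a₂ b₂ = -1 := if_neg (not_same ρ W hW ha₂ hb₂)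
  rw [hn]
  by_cases hA : ρ.SameCycle a₁ a₂
  · by_cases hB : ρ.SameCycle b₁ b₂
    · have e1 : cyc ρ a₁ a₂ = 1 := if_pos hA
      have e2 : cyc ρ b₁ b₂ = 1 := if_pos hB
      rcases cyc_cases (ρ * Equiv.swap a₂ b₂) a₁ b₁ with h | h <;> rw [h, e1, e2] <;> linarith
    · have hneg : cyc (ρ * Equiv.swap a₂ b₂) a₁ b₁ = -1 := by
        apply if_neg
        intro h
        rw [Equiv.Perm.sameCycle_comm, sameCycle_mul_swap _ _ _ _ _
          (fun h => not_same ρ W hW ha₂ hb₁ h.symm) hB] at h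
        exact not_same ρ W hW ha₁ hb₁ h.symm
      rw [hneg]
      rcases cyc_cases ρ a₁ a₂ with h | h <;> rcases cyc_cases ρ b₁ b₂ with h' | h' <;>
        rw [h, h'] <;> linarith
  · have hneg : cyc (ρ * Equiv.swap a₂ b₂) a₁ b₁ = -1 := by
      apply if_neg
      intro h
      rw [sameCycle_mul_swap _ _ _ _ _ hA (not_same ρ W hW ha₁ hb₂)] at h
      exact not_same ρ W hW ha₁ hb₁ h
    rw [hneg]
    rcases cyc_cases ρ a₁ a₂ with h | h <;> rcases cyc_cases ρ b₁ b₂ with h' | h' <;>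
      rw [h, h'] <;> linarith

theorem both_eq (ρ : Equiv.Perm α) (W : Set α)
    (hW : ∀ z, ρ z ∈ W ↔ z ∈ W) {a₁ a₂ b₁ b₂ : α} (ha₁ : a₁ ∈ W) (ha₂ : a₂ ∈ W)
    (hb₁ : b₁ ∉ W) (ha : a₁ ≠ a₂) (hb : b₁ ≠ b₂) :
    (numCycles (ρ * Equiv.swap a₁ a₂ * Equiv.swap b₁ b₂) : ℤ) =
      numCycles ρ + cyc ρ a₁ a₂ + cyc ρ b₁ b₂ := by
  rw [numCycles_swap _ _ _ hb, numCycles_swap _ _ _ ha]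
  congr 1
  unfold cyc
  rw [sameCycle_mul_swap _ _ _ _ _ (fun h => not_same ρ W hW ha₁ hb₁ h.symm)
    (fun h => not_same ρ W hW ha₂ hb₁ h.symm)]

/-- The choice of the optimal disconnected graph. -/
theorem exists_kappa {ι : Type*} (s : Finset ι) (hs : Odd s.card) (ρ₀ : Equiv.Perm α)
    (θ : ι → Equiv.Perm α) (W : Set α)
    (hW : ∀ c ∈ s, ∀ z, (θ c * ρ₀) z ∈ W ↔ z ∈ W) {a₁ a₂ b₁ b₂ : α} (ha₁ : a₁ ∈ W)
    (ha₂ : a₂ ∈ W) (hb₁ : b₁ ∉ W) (hb₂ : b₂ ∉ W) (ha : a₁ ≠ a₂) (hb : b₁ ≠ b₂) :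
    ∃ g : Equiv.Perm α, (∀ z, g z ∈ W ↔ z ∈ W) ∧
      (∀ z, z ≠ a₁ → z ≠ a₂ → z ≠ b₁ → z ≠ b₂ → g z = z) ∧
      ∑ c ∈ s, numCycles (θ c * (ρ₀ * Equiv.swap a₂ b₂ * Equiv.swap a₁ b₁)) <
        ∑ c ∈ s, numCycles (θ c * (ρ₀ * g * Equiv.swap a₁ b₁)) := by
  have hab : a₁ ≠ b₁ := fun e => hb₁ (e ▸ ha₁)
  set U : ℤ := ∑ c ∈ s, cyc (θ c * ρ₀) a₁ a₂ with hU
  set V : ℤ := ∑ c ∈ s, cyc (θ c * ρ₀) b₁ b₂ with hV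
  set N : ℤ := ∑ c ∈ s, (numCycles (θ c * ρ₀) : ℤ) with hN
  have hpar : ∀ x y : α, Odd (∑ c ∈ s, cyc (θ c * ρ₀) x y) := by
    intro x y
    have hcast : Odd (s.card : ℤ) := by exact_mod_cast hs
    have hev : Even (∑ c ∈ s, (cyc (θ c * ρ₀) x y - 1)) := by
      apply Finset.even_sum
      intro c _
      rcases cyc_cases (θ c * ρ₀) x y with h | h <;> rw [h] <;> decide
    rw [Finset.sum_sub_distrib] at hev
    simp only [Finset.sum_const, nsmul_eq_mul, mul_one] at hev
    have := hev.add_odd hcast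
    simpa using this
  have hUo : Odd U := hpar a₁ a₂
  have hVo : Odd V := hpar b₁ b₂
  have horig : 2 * (∑ c ∈ s,
      (numCycles (θ c * (ρ₀ * Equiv.swap a₂ b₂ * Equiv.swap a₁ b₁)) : ℤ)) ≤
      2 * N + U + V - 2 * s.card := by
    have : ∑ c ∈ s, 2 * (numCycles (θ c * (ρ₀ * Equiv.swap a₂ b₂ * Equiv.swap a₁ b₁)) : ℤ) ≤
      ∑ c ∈ s, (2 * (numCycles (θ c * ρ₀) : ℤ) + cyc (θ c * ρ₀) a₁ a₂ + cyc (θ c * ρ₀) b₁ b₂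
        - 2) := by
      apply Finset.sum_le_sum
      intro c hc
      have := orig_le (θ c * ρ₀) W (hW c hc) ha₁ ha₂ hb₁ hb₂
      simpa only [mul_assoc] using this
    rw [Finset.sum_sub_distrib, Finset.sum_add_distrib, Finset.sum_add_distrib, ← Finset.mul_sum,
      ← Finset.mul_sum] at this
    simp only [Finset.sum_const, nsmul_eq_mul] at this
    linarith
  have hlow : ∀ g : Equiv.Perm α, (∑ c ∈ s, (numCycles (θ c * ρ₀ * g) : ℤ)) - s.card ≤
      ∑ c ∈ s, (numCycles (θ c * (ρ₀ * g * Equiv.swap a₁ b₁)) : ℤ) := by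
    intro g
    have : ∑ c ∈ s, ((numCycles (θ c * ρ₀ * g) : ℤ) - 1) ≤
      ∑ c ∈ s, (numCycles (θ c * (ρ₀ * g * Equiv.swap a₁ b₁)) : ℤ) := by
      apply Finset.sum_le_sum
      intro c _
      have := numCycles_swap (θ c * ρ₀ * g) a₁ b₁ hab
      rw [show θ c * (ρ₀ * g * Equiv.swap a₁ b₁) = θ c * ρ₀ * g * Equiv.swap a₁ b₁ by
        simp only [mul_assoc], this]
      rcases cyc_cases (θ c * ρ₀ * g) a₁ b₁ with h | h <;> rw [h] <;> linarith
    rw [Finset.sum_sub_distrib] at this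
    simpa using this
  have hWa : ∀ z, Equiv.swap a₁ a₂ z ∈ W ↔ z ∈ W := by
    intro z
    rw [Equiv.swap_apply_def]; split_ifs with h1 h2 <;> simp_all
  have hWb : ∀ z, Equiv.swap b₁ b₂ z ∈ W ↔ z ∈ W := by
    intro z
    rw [Equiv.swap_apply_def]; split_ifs with h1 h2 <;> simp_all
  have fin : ∀ g : Equiv.Perm α, N + max 0 U + max 0 V ≤
      (∑ c ∈ s, (numCycles (θ c * ρ₀ * g) : ℤ)) →
      ∑ c ∈ s, numCycles (θ c * (ρ₀ * Equiv.swap a₂ b₂ * Equiv.swap a₁ b₁)) <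
        ∑ c ∈ s, numCycles (θ c * (ρ₀ * g * Equiv.swap a₁ b₁)) := by
    intro g hg
    have h1 := hlow g
    zify
    obtain ⟨u, hu⟩ := hUo
    obtain ⟨v, hv⟩ := hVo
    omega
  by_cases hU0 : 0 ≤ U <;> by_cases hV0 : 0 ≤ V
  · refine ⟨Equiv.swap a₁ a₂ * Equiv.swap b₁ b₂, ?_, ?_, fin _ ?_⟩
    · intro z; rw [Equiv.Perm.mul_apply, hWa, hWb]
    · intro z h1 h2 h3 h4
      rw [Equiv.Perm.mul_apply, Equiv.swap_apply_of_ne_of_ne h3 h4,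
        Equiv.swap_apply_of_ne_of_ne h1 h2]
    · have : ∑ c ∈ s, (numCycles (θ c * ρ₀ * (Equiv.swap a₁ a₂ * Equiv.swap b₁ b₂)) : ℤ) =
          N + U + V := by
        rw [hN, hU, hV, ← Finset.sum_add_distrib, ← Finset.sum_add_distrib]
        apply Finset.sum_congr rfl
        intro c hc
        rw [← mul_assoc]
        exact both_eq (θ c * ρ₀) W (hW c hc) ha₁ ha₂ hb₁ ha hb
      omega
  · refine ⟨Equiv.swap a₁ a₂, hWa, ?_, fin _ ?_⟩
    · intro z h1 h2 h3 h4
      rw [Equiv.swap_apply_of_ne_of_ne h1 h2]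
    · have : ∑ c ∈ s, (numCycles (θ c * ρ₀ * Equiv.swap a₁ a₂) : ℤ) = N + U := by
        rw [hN, hU, ← Finset.sum_add_distrib]
        exact Finset.sum_congr rfl fun c hc => numCycles_swap _ _ _ ha
      omega
  · refine ⟨Equiv.swap b₁ b₂, hWb, ?_, fin _ ?_⟩
    · intro z h1 h2 h3 h4
      rw [Equiv.swap_apply_of_ne_of_ne h3 h4]
    · have : ∑ c ∈ s, (numCycles (θ c * ρ₀ * Equiv.swap b₁ b₂) : ℤ) = N + V := by
        rw [hN, hV, ← Finset.sum_add_distrib]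
        exact Finset.sum_congr rfl fun c hc => numCycles_swap _ _ _ hb
      omega
  · refine ⟨1, fun z => Iff.rfl, fun z _ _ _ _ => rfl, fin _ ?_⟩
    simp only [mul_one]
    omega

end local_lemmas

theorem perm_apply_inv {α : Type*} (f : Equiv.Perm α) (x : α) : f (f⁻¹ x) = x :=
  Equiv.apply_symm_apply f x

theorem coloredConnected_of_eqvGen {n d : ℕ} (σ : Fin (d + 1) → Equiv.Perm (Fin n))
    (h : ∀ x y : Fin n, Relation.EqvGen
      (fun p q : Fin n ⊕ Fin n => ∃ (i : Fin n) (c : Fin (d + 1)),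
        p = Sum.inl i ∧ q = Sum.inr (σ c i)) (Sum.inl x) (Sum.inl y)) :
    ColoredConnected σ := by
  let Φ : Fin n ⊕ Fin n → Fin n := Sum.elim id (fun j => (σ 0)⁻¹ j)
  intro x y
  have key : ∀ p q, Relation.EqvGen
      (fun p q : Fin n ⊕ Fin n => ∃ (i : Fin n) (c : Fin (d + 1)),
        p = Sum.inl i ∧ q = Sum.inr (σ c i)) p q →
      ∃ g ∈ Subgroup.closure {g : Equiv.Perm (Fin n) | ∃ a b : Fin (d + 1), g = (σ a)⁻¹ * σ b},
      g (Φ p) = Φ q := by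
    intro p q hpq
    induction hpq with
    | rel p q h =>
      obtain ⟨i, c, rfl, rfl⟩ := h
      exact ⟨(σ 0)⁻¹ * σ c, Subgroup.subset_closure ⟨0, c, rfl⟩, rfl⟩
    | refl p => exact ⟨1, Subgroup.one_mem _, rfl⟩
    | symm p q _ ih =>
      obtain ⟨g, hg, h⟩ := ih
      exact ⟨g⁻¹, Subgroup.inv_mem _ hg, by rw [← h]; simp⟩
    | trans p q r _ _ ih1 ih2 =>
      obtain ⟨g, hg, h⟩ := ih1
      obtain ⟨g', hg', h'⟩ := ih2
      exact ⟨g' * g, Subgroup.mul_mem _ hg' hg, by rw [Equiv.Perm.mul_apply, h, h']⟩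
  exact key _ _ (h x y)

/-- **No 4-edge-cuts of color 0 in maximizers (odd dimension)**: for `d` odd, a connected
colored graph maximizing `C_0` among all connected colored graphs with the same bubbles
(i.e. over all choices of the color-0 permutation) has no 4-edge-cut consisting of four edges
of color 0. -/
theorem no_four_edge_cut {d n : ℕ} (hodd : Odd d)
    (σ : Fin (d + 1) → Equiv.Perm (Fin n)) (hconn : ColoredConnected σ)
    (hmax : ∀ τ₀ : Equiv.Perm (Fin n), ColoredConnected (Function.update σ 0 τ₀) →
      C0 (Function.update σ 0 τ₀) ≤ C0 σ) :
    ¬ ∃ E : Set (Fin n × Fin (d + 1)),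
        (∀ e ∈ E, e.2 = 0) ∧ E.ncard = 4 ∧ IsEdgeCut σ E := by
  classical
  rintro ⟨E, hE0, hE4, hcut, hmin⟩
  set r := Relation.EqvGen (fun p q : Fin n ⊕ Fin n => ∃ (i : Fin n) (c : Fin (d + 1)),
        (i, c) ∉ E ∧ p = Sum.inl i ∧ q = Sum.inr (σ c i)) with hr
  have rsymm : ∀ {p q}, r p q → r q p := fun h => Relation.EqvGen.symm _ _ h
  have rtrans : ∀ {p q s}, r p q → r q s → r p s := fun h h' => Relation.EqvGen.trans _ _ _ h h'
  have redge : ∀ i c, (i, c) ∉ E → r (Sum.inl i) (Sum.inr (σ c i)) := fun i c h =>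
    Relation.EqvGen.rel _ _ ⟨i, c, h, rfl, rfl⟩
  -- two classes
  have htwo : ∀ i, (i, (0 : Fin (d + 1))) ∈ E →
      ∀ z, r z (Sum.inl i) ∨ r z (Sum.inr (σ 0 i)) := by
    intro i hi z
    have hc := hmin (E \ {(i, 0)}) ⟨Set.diff_subset, fun h => (h hi).2 rfl⟩
    have key : ∀ p q, Relation.EqvGen (fun p q : Fin n ⊕ Fin n =>
        ∃ (j : Fin n) (c : Fin (d + 1)),
        (j, c) ∉ E \ {(i, 0)} ∧ p = Sum.inl j ∧ q = Sum.inr (σ c j)) p q →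
        ((r p (Sum.inl i) ∨ r p (Sum.inr (σ 0 i))) ↔
          (r q (Sum.inl i) ∨ r q (Sum.inr (σ 0 i)))) := by
      intro p q hpq
      induction hpq with
      | rel p q h =>
        obtain ⟨j, c, hj, rfl, rfl⟩ := h
        by_cases he : (j, c) ∈ E
        · have : (j, c) = (i, 0) := by
            by_contra hne
            exact hj ⟨he, hne⟩
          obtain ⟨rfl, rfl⟩ := Prod.mk.inj this
          exact ⟨fun _ => Or.inr (Relation.EqvGen.refl _),
            fun _ => Or.inl (Relation.EqvGen.refl _)⟩
        · have h1 := redge j c he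
          constructor
          · rintro (h | h)
            · exact Or.inl (rtrans (rsymm h1) h)
            · exact Or.inr (rtrans (rsymm h1) h)
          · rintro (h | h)
            · exact Or.inl (rtrans h1 h)
            · exact Or.inr (rtrans h1 h)
      | refl p => exact Iff.rfl
      | symm p q _ ih => exact ih.symm
      | trans p q s _ _ ih1 ih2 => exact ih1.trans ih2
    exact (key _ _ (hc (Sum.inl i) z)).1 (Or.inl (Relation.EqvGen.refl _))
  have hnr : ∀ i, (i, (0 : Fin (d + 1))) ∈ E → ¬ r (Sum.inl i) (Sum.inr (σ 0 i)) := by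
    intro i hi h
    apply hcut
    have : ∀ z, r z (Sum.inl i) := fun z => (htwo i hi z).elim id (fun h' => rtrans h' (rsymm h))
    exact fun x y => rtrans (this x) (rsymm (this y))
  have hEne : E.Nonempty := by
    rw [← Set.ncard_pos (Set.toFinite E)]; omega
  obtain ⟨⟨i₀, c₀⟩, hi₀⟩ := hEne
  obtain rfl : c₀ = 0 := hE0 _ hi₀
  set A : Fin n ⊕ Fin n → Prop := fun z => r z (Sum.inl i₀) with hA
  have hAr : ∀ {p q}, r p q → (A p ↔ A q) := fun h =>
    ⟨fun h' => rtrans (rsymm h) h', fun h' => rtrans h h'⟩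
  have hrA : ∀ {p q}, (A p ↔ A q) → r p q := by
    intro p q h
    by_cases hp : A p
    · exact rtrans hp (rsymm (h.1 hp))
    · have hq : ¬ A q := fun hq => hp (h.2 hq)
      have h1 := (htwo i₀ hi₀ p).resolve_left hp
      have h2 := (htwo i₀ hi₀ q).resolve_left hq
      exact rtrans h1 (rsymm h2)
  have hcross : ∀ i, (i, (0 : Fin (d + 1))) ∈ E →
      (A (Sum.inr (σ 0 i)) ↔ ¬ A (Sum.inl i)) := by
    intro i hi
    have := hnr i hi
    by_contra hne
    apply this
    apply hrA
    tauto
  have hncross : ∀ i c, (i, c) ∉ E → (A (Sum.inr (σ c i)) ↔ A (Sum.inl i)) :=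
    fun i c hi => (hAr (redge i c hi)).symm
  have hcne : ∀ i c, c ≠ 0 → (A (Sum.inr (σ c i)) ↔ A (Sum.inl i)) :=
    fun i c hc => hncross i c (fun h => hc (hE0 _ h))
  -- counting
  set E₀ : Finset (Fin n) := Finset.univ.filter (fun i => (i, (0 : Fin (d + 1))) ∈ E) with hE₀
  have hE₀card : E₀.card = 4 := by
    have : E = (E₀.image (fun i => (i, (0 : Fin (d + 1)))) : Finset _) := by
      ext ⟨i, c⟩
      simp only [hE₀, Finset.coe_image, Finset.coe_filter, Finset.mem_univ, true_and,
        Set.mem_image, Set.mem_setOf_eq, Prod.mk.injEq]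
      constructor
      · intro h
        have : c = 0 := hE0 _ h
        subst this
        exact ⟨i, h, rfl, rfl⟩
      · rintro ⟨j, h, rfl, rfl⟩; exact h
    rw [this, Set.ncard_coe_finset, Finset.card_image_of_injective] at hE4
    · exact hE4
    · intro a b h; exact (Prod.mk.inj h).1
  obtain ⟨c₁, hc₁⟩ : ∃ c : Fin (d + 1), c ≠ 0 := by
    refine ⟨Fin.last d, ?_⟩
    have := hodd.pos
    intro h
    have := congrArg Fin.val h
    simp at this
    omega
  set WA : Finset (Fin n) := Finset.univ.filter (fun i => A (Sum.inl i)) with hWA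
  set WB : Finset (Fin n) := Finset.univ.filter (fun i => A (Sum.inr (σ 0 i))) with hWB
  have hWcard : WA.card = WB.card := by
    apply Finset.card_bij (fun i _ => (σ 0)⁻¹ (σ c₁ i))
    · intro i hi
      simp only [hWA, hWB, Finset.mem_filter, Finset.mem_univ, true_and] at hi ⊢
      rw [perm_apply_inv]
      exact (hcne i c₁ hc₁).2 hi
    · intro a _ b _ h
      exact (σ c₁).injective ((σ 0)⁻¹.injective h)
    · intro b hb
      simp only [hWA, hWB, Finset.mem_filter, Finset.mem_univ, true_and] at hb
      refine ⟨(σ c₁)⁻¹ (σ 0 b), ?_, by simp⟩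
      simp only [hWA, Finset.mem_filter, Finset.mem_univ, true_and]
      rw [← hcne _ c₁ hc₁, perm_apply_inv]
      exact hb
  have h1 : WA \ WB = E₀.filter (fun i => A (Sum.inl i)) := by
    ext i
    simp only [hWA, hWB, hE₀, Finset.mem_sdiff, Finset.mem_filter, Finset.mem_univ, true_and]
    by_cases hi : (i, (0 : Fin (d + 1))) ∈ E
    · have := hcross i hi; tauto
    · have := hncross i 0 hi; tauto
  have h2 : WB \ WA = E₀.filter (fun i => ¬ A (Sum.inl i)) := by
    ext i
    simp only [hWA, hWB, hE₀, Finset.mem_sdiff, Finset.mem_filter, Finset.mem_univ, true_and]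
    by_cases hi : (i, (0 : Fin (d + 1))) ∈ E
    · have := hcross i hi; tauto
    · have := hncross i 0 hi; tauto
  have h3 := Finset.card_sdiff_comm hWcard
  have h4 := Finset.card_filter_add_card_filter_not (s := E₀) (fun i => A (Sum.inl i))
  rw [h1, h2] at h3
  obtain ⟨a₁, a₂, ha, hAs⟩ := Finset.card_eq_two.1
    (show (E₀.filter (fun i => A (Sum.inl i))).card = 2 by omega)
  obtain ⟨b₁, b₂, hb, hBs⟩ := Finset.card_eq_two.1
    (show (E₀.filter (fun i => ¬ A (Sum.inl i))).card = 2 by omega)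
  have memA : ∀ i, (i, (0 : Fin (d + 1))) ∈ E ∧ A (Sum.inl i) ↔ i = a₁ ∨ i = a₂ := by
    intro i
    have := Finset.ext_iff.1 hAs i
    simpa [hE₀] using this
  have memB : ∀ i, (i, (0 : Fin (d + 1))) ∈ E ∧ ¬ A (Sum.inl i) ↔ i = b₁ ∨ i = b₂ := by
    intro i
    have := Finset.ext_iff.1 hBs i
    simpa [hE₀] using this
  obtain ⟨ea₁, wa₁⟩ := (memA a₁).2 (Or.inl rfl)
  obtain ⟨ea₂, wa₂⟩ := (memA a₂).2 (Or.inr rfl)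
  obtain ⟨eb₁, wb₁⟩ := (memB b₁).2 (Or.inl rfl)
  obtain ⟨eb₂, wb₂⟩ := (memB b₂).2 (Or.inr rfl)
  have n11 : a₁ ≠ b₁ := fun e => wb₁ (e ▸ wa₁)
  have n12 : a₁ ≠ b₂ := fun e => wb₂ (e ▸ wa₁)
  have n21 : a₂ ≠ b₁ := fun e => wb₁ (e ▸ wa₂)
  have n22 : a₂ ≠ b₂ := fun e => wb₂ (e ▸ wa₂)
  have hother : ∀ i, i ≠ a₁ → i ≠ a₂ → i ≠ b₁ → i ≠ b₂ → (i, (0 : Fin (d + 1))) ∉ E := by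
    intro i h1 h2 h3 h4 hi
    by_cases hw : A (Sum.inl i)
    · rcases (memA i).1 ⟨hi, hw⟩ with h | h <;> contradiction
    · rcases (memB i).1 ⟨hi, hw⟩ with h | h <;> contradiction
  set ρ₀ : Equiv.Perm (Fin n) := σ 0 * Equiv.swap a₁ b₁ * Equiv.swap a₂ b₂ with hρ₀
  have hσ0 : ρ₀ * Equiv.swap a₂ b₂ * Equiv.swap a₁ b₁ = σ 0 := by
    rw [hρ₀, mul_assoc (σ 0 * _), Equiv.swap_mul_self, mul_one, mul_assoc, Equiv.swap_mul_self,
      mul_one]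
  have ra₁ : ρ₀ a₁ = σ 0 b₁ := by
    simp only [hρ₀, Equiv.Perm.mul_apply]
    rw [Equiv.swap_apply_of_ne_of_ne ha n12, Equiv.swap_apply_left]
  have rb₁ : ρ₀ b₁ = σ 0 a₁ := by
    simp only [hρ₀, Equiv.Perm.mul_apply]
    rw [Equiv.swap_apply_of_ne_of_ne n21.symm hb, Equiv.swap_apply_right]
  have ra₂ : ρ₀ a₂ = σ 0 b₂ := by
    simp only [hρ₀, Equiv.Perm.mul_apply]
    rw [Equiv.swap_apply_left, Equiv.swap_apply_of_ne_of_ne n12.symm hb.symm]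
  have rb₂ : ρ₀ b₂ = σ 0 a₂ := by
    simp only [hρ₀, Equiv.Perm.mul_apply]
    rw [Equiv.swap_apply_right, Equiv.swap_apply_of_ne_of_ne ha.symm n21]
  have rother : ∀ i, i ≠ a₁ → i ≠ a₂ → i ≠ b₁ → i ≠ b₂ → ρ₀ i = σ 0 i := by
    intro i h1 h2 h3 h4
    simp only [hρ₀, Equiv.Perm.mul_apply]
    rw [Equiv.swap_apply_of_ne_of_ne h2 h4, Equiv.swap_apply_of_ne_of_ne h1 h3]
  have hρA : ∀ i, A (Sum.inr (ρ₀ i)) ↔ A (Sum.inl i) := by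
    intro i
    by_cases h1 : i = a₁
    · rw [h1, ra₁, hcross b₁ eb₁]; tauto
    by_cases h2 : i = a₂
    · rw [h2, ra₂, hcross b₂ eb₂]; tauto
    by_cases h3 : i = b₁
    · rw [h3, rb₁, hcross a₁ ea₁]; tauto
    by_cases h4 : i = b₂
    · rw [h4, rb₂, hcross a₂ ea₂]; tauto
    rw [rother i h1 h2 h3 h4]
    exact hncross i 0 (hother i h1 h2 h3 h4)
  obtain ⟨g, hg1, hg2, hlt⟩ := exists_kappa (Finset.univ.erase (0 : Fin (d + 1)))
    (by rw [Finset.card_erase_of_mem (Finset.mem_univ _), Finset.card_univ, Fintype.card_fin]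
        simpa using hodd) ρ₀ (fun c => (σ c)⁻¹) {i | A (Sum.inl i)}
    (by
      intro c hc z
      have hc : c ≠ 0 := Finset.ne_of_mem_erase hc
      change A (Sum.inl ((σ c)⁻¹ (ρ₀ z))) ↔ A (Sum.inl z)
      rw [← hcne _ c hc, perm_apply_inv]
      exact hρA z) wa₁ wa₂ wb₁ wb₂ ha hb
  set τ := ρ₀ * g * Equiv.swap a₁ b₁ with hτ
  have hτa : ¬ A (Sum.inr (τ a₁)) := by
    rw [hτ, Equiv.Perm.mul_apply, Equiv.swap_apply_left, Equiv.Perm.mul_apply, hρA]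
    exact fun h => wb₁ ((hg1 b₁).1 h)
  have hτo : ∀ i, (i, (0 : Fin (d + 1))) ∉ E → τ i = σ 0 i := by
    intro i hi
    have h1 : i ≠ a₁ := fun e => hi (e ▸ ea₁)
    have h2 : i ≠ a₂ := fun e => hi (e ▸ ea₂)
    have h3 : i ≠ b₁ := fun e => hi (e ▸ eb₁)
    have h4 : i ≠ b₂ := fun e => hi (e ▸ eb₂)
    rw [hτ, Equiv.Perm.mul_apply, Equiv.swap_apply_of_ne_of_ne h1 h3, Equiv.Perm.mul_apply,
      hg2 i h1 h2 h3 h4, rother i h1 h2 h3 h4]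
  have hτc : ColoredConnected (Function.update σ 0 τ) := by
    apply coloredConnected_of_eqvGen
    set r' := Relation.EqvGen (fun p q : Fin n ⊕ Fin n => ∃ (i : Fin n) (c : Fin (d + 1)),
        p = Sum.inl i ∧ q = Sum.inr (Function.update σ 0 τ c i)) with hr'
    have hrr' : ∀ p q, r p q → r' p q := by
      intro p q h
      refine Relation.EqvGen.mono ?_ p q h
      rintro p q ⟨i, c, hi, rfl, rfl⟩
      refine ⟨i, c, rfl, ?_⟩
      by_cases hc : c = 0
      · subst hc; rw [Function.update_self, hτo i hi]
      · rw [Function.update_of_ne hc]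
    have hedge : r' (Sum.inl a₁) (Sum.inr (τ a₁)) :=
      Relation.EqvGen.rel _ _ ⟨a₁, 0, rfl, by rw [Function.update_self]⟩
    have hall : ∀ z, r' z (Sum.inl a₁) := by
      intro z
      by_cases hz : A z
      · exact hrr' _ _ (hrA (by tauto))
      · exact Relation.EqvGen.trans _ _ _ (hrr' _ _ (hrA (by tauto)))
          (Relation.EqvGen.symm _ _ hedge)
    exact fun x y => Relation.EqvGen.trans _ _ _ (hall _) (Relation.EqvGen.symm _ _ (hall _))
  have hle := hmax τ hτc
  have e1 : C0 (Function.update σ 0 τ) =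
      ∑ c ∈ Finset.univ.erase (0 : Fin (d + 1)), numCycles ((σ c)⁻¹ * τ) := by
    unfold C0
    apply Finset.sum_congr rfl
    intro c hc
    rw [Function.update_self, Function.update_of_ne (Finset.ne_of_mem_erase hc)]
  rw [e1] at hle
  rw [hσ0] at hlt
  exact absurd hle (not_le.2 hlt)
end

section
/- First-return permutations preserve the same-cycle relation (combinatorial content of the boundary-bubble proposition): Let α be a finite type, σ a permutation of α, and S a subset of α. For every x ∈ S there is a least integer k ≥ 1 with σ^k x ∈ S; setting σ_S x = σ^k x for this least k defines a permutation σ_S of S (the first-return map of σ on S). Then for all x, y ∈ S, x and y lie in the same cycle of σ if and only if they lie in the same cycle of σ_S. -/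
/-- **First-return permutations preserve the same-cycle relation**: let `σ` be a permutation of
a finite type `α` and `S ⊆ α`.  For every `x ∈ S` there is a least `k ≥ 1` with `σ^k x ∈ S`,
and the first-return map `π` of `σ` on `S` (characterized by `π x = σ^k x` for this least `k`)
is a permutation of `S` such that two elements of `S` lie in the same cycle of `σ` if and only
if they lie in the same cycle of `π`. -/
theorem first_return_sameCycle {α : Type*} [Fintype α] (σ : Equiv.Perm α) (S : Set α)
    (π : Equiv.Perm S)
    (hπ : ∀ x : S, ∃ k : ℕ, 1 ≤ k ∧ (π x : α) = (σ ^ k) (x : α) ∧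
      ∀ j : ℕ, 1 ≤ j → j < k → (σ ^ j) (x : α) ∉ S) :
    (∀ x : S, ∃ k : ℕ, 1 ≤ k ∧ (σ ^ k) (x : α) ∈ S) ∧
      ∀ x y : S, σ.SameCycle (x : α) (y : α) ↔ π.SameCycle x y := by
  refine ⟨fun x => ?_, fun x y => ⟨?_, ?_⟩⟩
  · obtain ⟨k, hk, hx, -⟩ := hπ x
    exact ⟨k, hk, hx ▸ (π x).2⟩
  · have key : ∀ n : ℕ, ∀ x y : S, (σ ^ n) (x : α) = y → π.SameCycle x y := by
      intro n
      induction n using Nat.strong_induction_on with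
      | _ n ih =>
        intro x y h
        obtain ⟨k, hk, hx, hmin⟩ := hπ x
        rcases Nat.eq_zero_or_pos n with rfl | hn
        · have hxy : x = y := Subtype.ext (by simpa using h)
          exact hxy ▸ Equiv.Perm.SameCycle.refl π x
        · have hkn : k ≤ n := by
            by_contra hlt
            exact hmin n hn (by omega) (h ▸ y.2)
          have h2 : (σ ^ (n - k)) ((π x : S) : α) = y := by
            rw [hx, ← Equiv.Perm.mul_apply, ← pow_add, Nat.sub_add_cancel hkn, h]
          exact Equiv.Perm.sameCycle_apply_left.1 (ih (n - k) (by omega) (π x) y h2)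
    intro h
    obtain ⟨n, hn⟩ := h.exists_nat_pow_eq
    exact key n x y hn
  · have step : ∀ x : S, σ.SameCycle (x : α) (π x : S) := by
      intro x
      obtain ⟨k, -, hx, -⟩ := hπ x
      exact ⟨k, by rw [hx, zpow_natCast]⟩
    have key : ∀ n : ℕ, ∀ x : S, σ.SameCycle (x : α) ((π ^ n) x : S) := by
      intro n
      induction n with
      | zero => intro x; exact Equiv.Perm.SameCycle.refl σ _
      | succ n ih =>
        intro x
        rw [pow_succ', Equiv.Perm.mul_apply]
        exact (ih x).trans (step _)
    intro h
    have : Finite S := inferInstance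
    obtain ⟨n, hn⟩ := h.exists_nat_pow_eq
    exact hn ▸ key n x
end
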